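/- arXiv:1309.0482 — 2 statements merged into one kernel-verified Lean document; each statement's English description precedes it below -/
import Mathlib

section
/- If the dimension p is fixed, then (log det Σ̂ − p(p+1)/(2n) − log det Σ)/√(2p/n) → N(0,1) in distribution as n → ∞. -/
open MeasureTheory ProbabilityTheory Filter Matrix

/-- `ν` is the multivariate Gaussian distribution `N_p(m, S)` on `ℝ^p`: it is a probability
measure and the pushforward under any linear functional `x ↦ ⟨l, x⟩` is the univariate
Gaussian with mean `⟨l, m⟩` and variance `lᵀ S l`. -/
def IsMvGaussian {p : ℕ} (m : Fin p → ℝ) (S : Matrix (Fin p) (Fin p) ℝ)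
    (ν : Measure (Fin p → ℝ)) : Prop :=
  IsProbabilityMeasure ν ∧
    ∀ l : Fin p → ℝ,
      ν.map (fun x => ∑ i, l i * x i) =
        gaussianReal (∑ i, l i * m i) (Real.toNNReal (l ⬝ᵥ (S *ᵥ l)))

/-- The sample covariance matrix `Σ̂` based on the `n+1` observations `X 0, …, X n`. -/
noncomputable def sampleCov {n p : ℕ} (X : Fin (n + 1) → Fin p → ℝ) :
    Matrix (Fin p) (Fin p) ℝ :=
  Matrix.of fun i j =>
    (1 / (n : ℝ)) * ∑ k, (X k i - (∑ l, X l i) / (n + 1)) * (X k j - (∑ l, X l j) / (n + 1))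

/-- The standard Gaussian cumulative distribution function. -/
noncomputable def stdGaussianCDF (x : ℝ) : ℝ := (gaussianReal 0 1 (Set.Iic x)).toReal

section Auxiliary

open scoped ENNReal NNReal Topology

lemma integral_pow_four_gaussianReal : ∫ x, x ^ 4 ∂(gaussianReal 0 1) = 3 := by
  have h : iteratedDeriv 4 (mgf (fun x ↦ x) (gaussianReal 0 1)) 0 =
      ∫ x, x ^ 4 ∂(gaussianReal 0 1) := by
    rw [iteratedDeriv_mgf_zero] <;> simp
  rw [← h, mgf_fun_id_gaussianReal]
  have step (q q' : ℝ → ℝ) (hq : ∀ t, HasDerivAt q (q' t) t) :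
      deriv (fun t ↦ q t * Real.exp (t ^ 2 / 2)) =
        fun t ↦ (q' t + q t * t) * Real.exp (t ^ 2 / 2) := by
    ext t
    have he : HasDerivAt (fun t : ℝ ↦ Real.exp (t ^ 2 / 2)) (Real.exp (t ^ 2 / 2) * t) t := by
      convert! (((hasDerivAt_pow 2 t).div_const 2).exp) using 1
      simp
    rw [show (fun t ↦ q t * Real.exp (t ^ 2 / 2)) = q * fun t ↦ Real.exp (t ^ 2 / 2) from rfl,
      ((hq t).mul he).deriv]
    ring
  have h0 : (fun t : ℝ ↦ Real.exp (0 * t + ((1 : ℝ≥0) : ℝ) * t ^ 2 / 2)) =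
      fun t ↦ (fun _ ↦ (1 : ℝ)) t * Real.exp (t ^ 2 / 2) := by
    ext t; simp
  rw [h0, iteratedDeriv_eq_iterate]
  simp only [Function.iterate_succ, Function.iterate_zero, Function.comp, id]
  rw [step (fun _ ↦ 1) (fun _ ↦ 0) fun t ↦ hasDerivAt_const t 1,
    step (fun t ↦ 0 + 1 * t) (fun _ ↦ 1) fun t ↦ by
      simpa using hasDerivAt_id' t,
    step (fun t ↦ 1 + (0 + 1 * t) * t) (fun t ↦ 2 * t) fun t ↦ by
      convert! (hasDerivAt_pow 2 t).const_add 1 using 1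
      · ext; ring
      · simp,
    step (fun t ↦ 2 * t + (1 + (0 + 1 * t) * t) * t) (fun t ↦ 3 + 3 * t ^ 2) fun t ↦ by
      convert! ((hasDerivAt_id t).const_mul 3).add (hasDerivAt_pow 3 t) using 1
      · ext; simp; ring
      · simp]
  simp

lemma integral_sq_gaussianReal : ∫ x, x ^ 2 ∂(gaussianReal 0 1) = 1 := by
  have h := variance_eq_integral (X := fun x ↦ x) (μ := gaussianReal 0 1) (by fun_prop)
  simpa using h.symm

lemma memLp_sq_gaussianReal : MemLp (fun x : ℝ ↦ x ^ 2) 2 (gaussianReal 0 1) := by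
  have h := memLp_id_gaussianReal' (μ := 0) (v := 1) 4 (by simp)
  have : ENNReal.HolderTriple 4 4 2 := ⟨by
    rw [← ENNReal.toReal_eq_toReal_iff' (by simp) (by simp), ENNReal.toReal_add (by simp) (by simp)]
    norm_num⟩
  convert! h.mul (r := 2) h using 1
  ext; simp [sq]

lemma variance_sq_gaussianReal : Var[fun x ↦ x ^ 2; gaussianReal 0 1] = 2 := by
  rw [variance_eq_sub memLp_sq_gaussianReal]
  have : ∀ x : ℝ, (x ^ 2) ^ 2 = x ^ 4 := fun x ↦ by ring
  simp only [Pi.pow_apply, this, integral_pow_four_gaussianReal, integral_sq_gaussianReal]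
  norm_num

lemma hasFDerivAt_det_one_add {p : ℕ} :
    ∃ D : (Fin p → Fin p → ℝ) →L[ℝ] ℝ, (∀ M : Fin p → Fin p → ℝ, D M = ∑ i, M i i) ∧
      HasFDerivAt (fun M : Fin p → Fin p → ℝ ↦ (1 + Matrix.of M).det) D 0 := by
  have hd : Differentiable ℝ (fun M : Fin p → Fin p → ℝ ↦ (1 + Matrix.of M).det) := by
    simp only [Matrix.det_apply, Matrix.add_apply, Matrix.of_apply]
    fun_prop
  refine ⟨_, fun M ↦ ?_, (hd _).hasFDerivAt⟩
  have h1 : HasDerivAt (fun t : ℝ ↦ (1 + Matrix.of (t • M)).det) (∑ i, M i i) 0 := by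
    have h2 (t : ℝ) : (1 + Matrix.of (t • M)).det = _ := Matrix.det_one_add_smul t (Matrix.of M)
    simp only [h2]
    set q := (1 + (Polynomial.X : Polynomial ℝ) • (Matrix.of M).map Polynomial.C).det.divX.divX
    have := (((hasDerivAt_id' (0 : ℝ)).const_mul (Matrix.of M).trace).const_add 1).add
      ((q.hasDerivAt 0).mul (hasDerivAt_pow 2 (0 : ℝ)))
    convert! this using 1
    simp [Matrix.trace]
  have h3 : HasDerivAt (fun t : ℝ ↦ t • M) M 0 := by
    simpa using (hasDerivAt_id' (0 : ℝ)).smul_const M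
  have h4 := HasFDerivAt.comp_hasDerivAt (𝕜 := ℝ) 0
    (by simpa using (hd 0).hasFDerivAt) h3
  exact h4.unique h1

lemma log_mul_det_isLittleO {p : ℕ} {s : ℝ} (hs : 0 < s) :
    (fun M : Fin p → Fin p → ℝ ↦
      Real.log (s * (1 + Matrix.of M).det) - Real.log s - ∑ i, M i i) =o[𝓝 0] fun M ↦ M := by
  obtain ⟨D, hD, h⟩ := hasFDerivAt_det_one_add (p := p)
  have h0 : (1 + Matrix.of (0 : Fin p → Fin p → ℝ)).det = 1 := by
    rw [show Matrix.of (0 : Fin p → Fin p → ℝ) = 0 from rfl]; simp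
  have h1 := ((h.const_mul s).log (by simp [hs.ne'])).isLittleO
  simpa [h0, hD, hs.ne'] using h1

/-- A sequence of random variables that is bounded in probability (tight), `Y n = O_P(1)`. -/
def BoundedInProb {Ω : Type*} [MeasurableSpace Ω] (P : Measure Ω) (Y : ℕ → Ω → ℝ) : Prop :=
  ∀ ε : ℝ≥0∞, 0 < ε → ∃ M : ℝ, 0 < M ∧ ∀ n, P {ω | M ≤ |Y n ω|} ≤ ε

section BoundedInProb

variable {Ω : Type*} [MeasurableSpace Ω] {P : Measure Ω} {Y Z : ℕ → Ω → ℝ}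

lemma BoundedInProb.mono (hY : BoundedInProb P Y) (h : ∀ n ω, |Z n ω| ≤ |Y n ω|) :
    BoundedInProb P Z := fun ε hε ↦ by
  obtain ⟨M, hM, hb⟩ := hY ε hε
  exact ⟨M, hM, fun n ↦ (measure_mono fun ω (hω : M ≤ _) ↦ hω.trans (h n ω)).trans (hb n)⟩

lemma BoundedInProb.add (hY : BoundedInProb P Y) (hZ : BoundedInProb P Z) :
    BoundedInProb P fun n ω ↦ Y n ω + Z n ω := fun ε hε ↦ by
  obtain ⟨M, hM, hMb⟩ := hY (ε / 2) (ENNReal.half_pos hε.ne')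
  obtain ⟨N, hN, hNb⟩ := hZ (ε / 2) (ENNReal.half_pos hε.ne')
  refine ⟨M + N, add_pos hM hN, fun n ↦ ?_⟩
  refine (measure_mono (t := {ω | M ≤ |Y n ω|} ∪ {ω | N ≤ |Z n ω|}) fun ω hω ↦ ?_).trans
    ((measure_union_le _ _).trans ((add_le_add (hMb n) (hNb n)).trans_eq (ENNReal.add_halves ε)))
  by_contra! hc
  simp only [Set.mem_union, Set.mem_ofPred_eq, not_or, not_le] at hc hω
  linarith [abs_add_le (Y n ω) (Z n ω)]

lemma BoundedInProb.mul (hY : BoundedInProb P Y) (hZ : BoundedInProb P Z) :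
    BoundedInProb P fun n ω ↦ Y n ω * Z n ω := fun ε hε ↦ by
  obtain ⟨M, hM, hMb⟩ := hY (ε / 2) (ENNReal.half_pos hε.ne')
  obtain ⟨N, hN, hNb⟩ := hZ (ε / 2) (ENNReal.half_pos hε.ne')
  refine ⟨M * N, mul_pos hM hN, fun n ↦ ?_⟩
  refine (measure_mono (t := {ω | M ≤ |Y n ω|} ∪ {ω | N ≤ |Z n ω|}) fun ω hω ↦ ?_).trans
    ((measure_union_le _ _).trans ((add_le_add (hMb n) (hNb n)).trans_eq (ENNReal.add_halves ε)))
  by_contra! hc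
  simp only [Set.mem_union, Set.mem_ofPred_eq, not_or, not_le, abs_mul] at hc hω
  exact absurd hω (not_le.2 (mul_lt_mul'' hc.1 hc.2 (abs_nonneg _) (abs_nonneg _)))

lemma boundedInProb_of_abs_le {C : ℝ} (h : ∀ n ω, |Y n ω| ≤ C) : BoundedInProb P Y :=
  fun ε _ ↦ ⟨|C| + 1, by positivity, fun n ↦ by
    rw [show {ω | |C| + 1 ≤ |Y n ω|} = ∅ from Set.eq_empty_of_forall_notMem
      fun ω (hω : |C| + 1 ≤ |Y n ω|) ↦ by linarith [h n ω, le_abs_self C]]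
    simp⟩

lemma BoundedInProb.sum {ι : Type*} (s : Finset ι) {Y : ι → ℕ → Ω → ℝ}
    (h : ∀ i ∈ s, BoundedInProb P (Y i)) : BoundedInProb P fun n ω ↦ ∑ i ∈ s, Y i n ω := by
  classical
  induction s using Finset.induction_on with
  | empty => exact boundedInProb_of_abs_le (C := 0) (by simp)
  | insert i s hi ih =>
    simp only [Finset.sum_insert hi]
    exact (h i (Finset.mem_insert_self i s)).add (ih fun j hj ↦ h j (Finset.mem_insert_of_mem hj))

lemma BoundedInProb.tendstoInMeasure_mul (hY : BoundedInProb P Y) {a : ℕ → ℝ}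
    (ha : Tendsto a atTop (𝓝 0)) :
    TendstoInMeasure P (fun n ω ↦ a n * Y n ω) atTop 0 := by
  rw [tendstoInMeasure_iff_norm]
  intro ε hε
  rw [ENNReal.tendsto_atTop_zero]
  intro δ hδ
  obtain ⟨M, hM, hb⟩ := hY δ hδ
  have h := (ha.abs).eventually_lt_const (u := ε / M) (by simpa using div_pos hε hM)
  obtain ⟨N, hN⟩ := eventually_atTop.1 h
  refine ⟨N, fun n hn ↦ (measure_mono fun ω hω ↦ ?_).trans (hb n)⟩
  simp only [Pi.zero_apply, sub_zero, Real.norm_eq_abs, abs_mul, Set.mem_ofPred_eq] at hω ⊢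
  by_contra! hc
  have h1 := mul_lt_mul'' (hN n hn) hc (abs_nonneg _) (abs_nonneg _)
  rw [div_mul_cancel₀ _ hM.ne'] at h1
  linarith

lemma tendstoInMeasure_add_zero {X Y : ℕ → Ω → ℝ} (hX : TendstoInMeasure P X atTop 0)
    (hY : TendstoInMeasure P Y atTop 0) :
    TendstoInMeasure P (fun n ω ↦ X n ω + Y n ω) atTop 0 := by
  rw [tendstoInMeasure_iff_norm] at *
  intro ε hε
  have h := (hX (ε / 2) (half_pos hε)).add (hY (ε / 2) (half_pos hε))
  rw [add_zero] at h
  refine tendsto_of_tendsto_of_tendsto_of_le_of_le tendsto_const_nhds h (fun _ ↦ zero_le)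
    fun n ↦ (measure_mono fun ω hω ↦ ?_).trans (measure_union_le _ _)
  by_contra! hc
  simp only [Set.mem_union, Set.mem_ofPred_eq, not_or, not_le, Pi.zero_apply, sub_zero,
    Real.norm_eq_abs] at hc hω
  linarith [abs_add_le (X n ω) (Y n ω)]

/-- The remainder in the delta method is negligible. -/
lemma tendstoInMeasure_remainder {E : Type*} [NormedAddCommGroup E] [NormedSpace ℝ E]
    {G : ℕ → Ω → E} (hG : BoundedInProb P fun n ω ↦ ‖G n ω‖) {R : E → ℝ}
    (hR : R =o[𝓝 0] fun x ↦ x) {c : ℕ → ℝ} (hc : Tendsto c atTop atTop) :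
    TendstoInMeasure P (fun n ω ↦ c n * R ((c n)⁻¹ • G n ω)) atTop 0 := by
  rw [tendstoInMeasure_iff_norm]
  intro ε hε
  rw [ENNReal.tendsto_atTop_zero]
  intro δ hδ
  obtain ⟨M, hM, hb⟩ := hG δ hδ
  obtain ⟨r, hr, hball⟩ := Metric.eventually_nhds_iff.1 (hR.def (div_pos hε hM))
  obtain ⟨N, hN⟩ := eventually_atTop.1 (hc.eventually_gt_atTop (max 0 (M / r)))
  refine ⟨N, fun n hn ↦ (measure_mono fun ω hω ↦ ?_).trans (hb n)⟩
  simp only [Pi.zero_apply, sub_zero, Real.norm_eq_abs, abs_mul, Set.mem_ofPred_eq,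
    abs_norm] at hω ⊢
  by_contra! hlt
  obtain ⟨h0, h1⟩ := max_lt_iff.1 (hN n hn)
  have hnorm : ‖(c n)⁻¹ • G n ω‖ = ‖G n ω‖ / c n := by
    rw [norm_smul, norm_inv, Real.norm_eq_abs, abs_of_pos h0, div_eq_inv_mul]
  have h2 := hball (y := (c n)⁻¹ • G n ω) (by
    rw [dist_zero_right, hnorm, div_lt_iff₀ h0]
    rw [div_lt_iff₀ hr] at h1
    linarith)
  rw [hnorm, Real.norm_eq_abs] at h2
  have h3 : |c n| * |R ((c n)⁻¹ • G n ω)| ≤ ε / M * ‖G n ω‖ := by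
    rw [abs_of_pos h0]
    calc _ ≤ c n * (ε / M * (‖G n ω‖ / c n)) := by gcongr
      _ = _ := by field_simp
  have h4 : ε / M * ‖G n ω‖ < ε := by
    calc _ < ε / M * M := by gcongr
      _ = ε := by field_simp
  linarith

end BoundedInProb

section Representation

open WithLp Complex
open scoped RealInnerProductSpace MatrixOrder

lemma IsMvGaussian.map_toLp {p : ℕ} {m : Fin p → ℝ} {S : Matrix (Fin p) (Fin p) ℝ}
    (hS : S.PosSemidef) {ν : Measure (Fin p → ℝ)} (hν : IsMvGaussian m S ν) :
    ν.map (toLp 2) = multivariateGaussian (toLp 2 m) S := by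
  have := hν.1
  have : IsProbabilityMeasure (ν.map (toLp 2)) := Measure.isProbabilityMeasure_map (by fun_prop)
  refine Measure.ext_of_charFun (E := EuclideanSpace ℝ (Fin p)) (funext fun t ↦ ?_)
  have h := congrArg (fun μ ↦ charFun μ 1) (hν.2 (ofLp t))
  simp only [charFun_gaussianReal] at h
  rw [charFun_apply_real, integral_map (Measurable.aemeasurable (by fun_prop)) (by fun_prop)] at h
  have hnn : 0 ≤ ofLp t ⬝ᵥ S *ᵥ ofLp t := by simpa using hS.dotProduct_mulVec_nonneg (ofLp t)
  rw [charFun_multivariateGaussian hS, charFun_apply, integral_map (by fun_prop) (by fun_prop)]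
  convert! h using 1
  · congr with x
    simp [PiLp.inner_apply, mul_comm]
  · simp [PiLp.inner_apply, hnn, mul_comm]

/-- A Gaussian vector is an affine image of a standard Gaussian vector. -/
lemma IsMvGaussian.exists_eq_map {p : ℕ} {m : Fin p → ℝ} {S : Matrix (Fin p) (Fin p) ℝ}
    (hS : S.PosSemidef) {ν : Measure (Fin p → ℝ)} (hν : IsMvGaussian m S ν) :
    ∃ A : Matrix (Fin p) (Fin p) ℝ, A * Aᵀ = S ∧
      ν = (Measure.pi fun _ : Fin p ↦ gaussianReal 0 1).map fun z ↦ m + A *ᵥ z := by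
  refine ⟨CFC.sqrt S, ?_, ?_⟩
  · have h : IsSelfAdjoint (CFC.sqrt S) := (CFC.sqrt_nonneg S).isSelfAdjoint
    rw [← Matrix.conjTranspose_eq_transpose_of_trivial, ← Matrix.star_eq_conjTranspose, h.star_eq,
      CFC.sqrt_mul_sqrt_self _ hS.nonneg]
  · have h := congrArg (Measure.map ofLp) (hν.map_toLp hS)
    rw [Measure.map_map (by fun_prop) (by fun_prop)] at h
    rw [multivariateGaussian, ← map_pi_eq_stdGaussian, Measure.map_map (by fun_prop) (by fun_prop),
      Measure.map_map (by fun_prop) (by fun_prop)] at h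
    convert! h using 1
    exact Measure.map_id.symm

end Representation

section SampleCov

variable {n p : ℕ}

lemma sampleCov_eq_smul_mul (X : Fin (n + 1) → Fin p → ℝ) :
    sampleCov X = (1 / (n : ℝ)) •
      ((Matrix.of fun k i ↦ X k i - (∑ l, X l i) / (n + 1))ᵀ *
        Matrix.of fun k i ↦ X k i - (∑ l, X l i) / (n + 1)) := by
  ext i j
  simp [sampleCov, Matrix.mul_apply]

lemma sampleCov_affine (m : Fin p → ℝ) (A : Matrix (Fin p) (Fin p) ℝ)
    (z : Fin (n + 1) → Fin p → ℝ) :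
    sampleCov (fun k ↦ m + A *ᵥ z k) = A * sampleCov z * Aᵀ := by
  have h : (Matrix.of fun k i ↦ (m + A *ᵥ z k) i - (∑ l, (m + A *ᵥ z l) i) / (n + 1)) =
      (Matrix.of fun k i ↦ z k i - (∑ l, z l i) / (n + 1)) * Aᵀ := by
    ext k i
    simp only [Matrix.of_apply, Matrix.mul_apply, Matrix.transpose_apply, Pi.add_apply,
      Matrix.mulVec, dotProduct, Finset.sum_add_distrib, Finset.sum_const, Finset.card_univ,
      Fintype.card_fin, nsmul_eq_mul, sub_mul, Finset.sum_sub_distrib]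
    rw [Finset.sum_comm]
    have : ∑ a, (∑ l, z l a) / (n + 1 : ℝ) * A i a = (∑ a, ∑ l, A i a * z l a) / (n + 1 : ℝ) := by
      rw [Finset.sum_div]
      refine Finset.sum_congr rfl fun a _ ↦ ?_
      rw [← Finset.mul_sum]
      ring
    rw [this]
    simp only [mul_comm (z k _)]
    have : (n + 1 : ℝ) ≠ 0 := by positivity
    push_cast
    field_simp
    ring
  rw [sampleCov_eq_smul_mul, sampleCov_eq_smul_mul, h, Matrix.transpose_mul,
    Matrix.transpose_transpose]
  simp only [Matrix.mul_smul, Matrix.smul_mul, Matrix.mul_assoc]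

lemma det_sampleCov_affine {m : Fin p → ℝ} {A S : Matrix (Fin p) (Fin p) ℝ} (hA : A * Aᵀ = S)
    (z : Fin (n + 1) → Fin p → ℝ) :
    (sampleCov fun k ↦ m + A *ᵥ z k).det = S.det * (sampleCov z).det := by
  rw [sampleCov_affine, ← hA]
  simp only [Matrix.det_mul, Matrix.det_transpose]
  ring

lemma sampleCov_apply (z : Fin (n + 1) → Fin p → ℝ) (i j : Fin p) :
    sampleCov z i j =
      (1 / (n : ℝ)) * (∑ k, z k i * z k j - (∑ k, z k i) * (∑ k, z k j) / (n + 1)) := by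
  have : (n + 1 : ℝ) ≠ 0 := by positivity
  simp only [sampleCov, Matrix.of_apply, sub_mul, mul_sub, Finset.sum_sub_distrib,
    ← Finset.sum_mul, ← Finset.mul_sum, Finset.sum_const, Finset.card_univ, Fintype.card_fin,
    nsmul_eq_mul]
  push_cast
  field_simp
  ring

end SampleCov

section StandardGaussian

variable {p : ℕ}

lemma memLp_eval_pi_gaussianReal (i : Fin p) {q : ℝ≥0∞} (hq : q ≠ ∞) :
    MemLp (fun z : Fin p → ℝ ↦ z i) q (Measure.pi fun _ ↦ gaussianReal 0 1) :=
  (memLp_id_gaussianReal' q hq).comp_measurePreserving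
    (measurePreserving_eval (fun _ : Fin p ↦ gaussianReal 0 1) i)

lemma memLp_eval_mul_eval_pi_gaussianReal (i j : Fin p) :
    MemLp (fun z : Fin p → ℝ ↦ z i * z j) 2 (Measure.pi fun _ ↦ gaussianReal 0 1) := by
  have : ENNReal.HolderTriple 4 4 2 := ⟨by
    rw [← ENNReal.toReal_eq_toReal_iff' (by simp) (by simp), ENNReal.toReal_add (by simp) (by simp)]
    norm_num⟩
  exact (memLp_eval_pi_gaussianReal j (by simp)).mul (p := 4) (q := 4)
    (memLp_eval_pi_gaussianReal i (by simp))

lemma integral_eval_pi_gaussianReal (i : Fin p) :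
    ∫ z : Fin p → ℝ, z i ∂(Measure.pi fun _ ↦ gaussianReal 0 1) = 0 := by
  have h := (measurePreserving_eval (fun _ : Fin p ↦ gaussianReal 0 1) i)
  have h1 := integral_map (μ := Measure.pi fun _ : Fin p ↦ gaussianReal 0 1)
    h.measurable.aemeasurable (f := fun x : ℝ ↦ x) (by fun_prop)
  rw [h.map_eq] at h1
  simpa using h1.symm

lemma integral_eval_sq_pi_gaussianReal (i : Fin p) :
    ∫ z : Fin p → ℝ, z i ^ 2 ∂(Measure.pi fun _ ↦ gaussianReal 0 1) = 1 := by
  have h := (measurePreserving_eval (fun _ : Fin p ↦ gaussianReal 0 1) i)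
  have h1 := integral_map (μ := Measure.pi fun _ : Fin p ↦ gaussianReal 0 1)
    h.measurable.aemeasurable (f := fun x : ℝ ↦ x ^ 2) (by fun_prop)
  rw [h.map_eq, integral_sq_gaussianReal] at h1
  exact h1.symm

lemma integral_eval_mul_eval_pi_gaussianReal (i j : Fin p) :
    ∫ z : Fin p → ℝ, z i * z j ∂(Measure.pi fun _ ↦ gaussianReal 0 1) =
      (1 : Matrix (Fin p) (Fin p) ℝ) i j := by
  rcases eq_or_ne i j with rfl | hij
  · simpa [sq] using integral_eval_sq_pi_gaussianReal i
  · have h := (iIndepFun_pi (μ := fun _ : Fin p ↦ gaussianReal 0 1) (X := fun _ x ↦ x)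
      (by fun_prop)).indepFun hij
    have h1 := h.integral_fun_mul_eq_mul_integral (measurable_pi_apply i).aestronglyMeasurable
      (measurable_pi_apply j).aestronglyMeasurable
    rw [h1]
    simp [integral_eval_pi_gaussianReal, hij]

lemma variance_sum_sq_pi_gaussianReal :
    Var[fun z : Fin p → ℝ ↦ ∑ i, z i ^ 2; Measure.pi fun _ ↦ gaussianReal 0 1] = 2 * p := by
  have h := variance_sum_pi (ι := Fin p) (μ := fun _ ↦ gaussianReal 0 1) (X := fun _ x ↦ x ^ 2)
    fun _ ↦ memLp_sq_gaussianReal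
  simp only [variance_sq_gaussianReal] at h
  convert! h using 1
  · congr with z
    simp
  · simp [mul_comm]

end StandardGaussian

section IID

variable {E : Type*} [MeasurableSpace E] {γ : Measure E} [IsProbabilityMeasure γ] {h : E → ℝ}

lemma iIndepFun_eval_infinitePi (hm : Measurable h) :
    iIndepFun (fun (k : ℕ) (ω : ℕ → E) ↦ h (ω k)) (Measure.infinitePi fun _ ↦ γ) :=
  iIndepFun_infinitePi (X := fun _ ↦ h) fun _ ↦ hm

lemma identDistrib_eval_infinitePi (hm : Measurable h) (k : ℕ) :
    IdentDistrib (fun ω : ℕ → E ↦ h (ω k)) h (Measure.infinitePi fun _ ↦ γ) γ where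
  aemeasurable_fst := (hm.comp (measurable_pi_apply k)).aemeasurable
  aemeasurable_snd := hm.aemeasurable
  map_eq := by
    have := Measure.map_map (μ := Measure.infinitePi fun _ : ℕ ↦ γ) hm
      (measurable_pi_apply (X := fun _ : ℕ ↦ E) k)
    rw [← Function.comp_def, ← this]
    congr 1
    exact (measurePreserving_eval_infinitePi (fun _ : ℕ ↦ γ) k).map_eq

lemma boundedInProb_inv_sqrt_mul_sum (hm : Measurable h) (hL : MemLp h 2 γ) (h0 : ∫ x, h x ∂γ = 0) :
    BoundedInProb (Measure.infinitePi fun _ : ℕ ↦ γ)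
      fun n ω ↦ (√(n + 1 : ℝ))⁻¹ * ∑ k ∈ Finset.range (n + 1), h (ω k) := by
  intro ε hε
  have hlim : Tendsto (fun M : ℝ ↦ ENNReal.ofReal (Var[h; γ] / M ^ 2)) atTop (𝓝 0) := by
    rw [← ENNReal.ofReal_zero]
    exact ENNReal.tendsto_ofReal (Tendsto.const_div_atTop (tendsto_pow_atTop two_ne_zero) _)
  obtain ⟨M, hM, hM0⟩ := ((hlim.eventually_le_const hε).and (eventually_gt_atTop 0)).exists
  refine ⟨M, hM0, fun n ↦ ?_⟩
  have hLk (k : ℕ) := (identDistrib_eval_infinitePi (γ := γ) hm k).memLp_iff.2 hL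
  have hS : MemLp (∑ k ∈ Finset.range (n + 1), fun ω : ℕ → E ↦ h (ω k)) 2
      (Measure.infinitePi fun _ : ℕ ↦ γ) := memLp_finsetSum' _ fun k _ ↦ hLk k
  have hV := IndepFun.variance_sum (s := Finset.range (n + 1)) (fun k _ ↦ hLk k)
    fun i _ j _ hij ↦ (iIndepFun_eval_infinitePi (γ := γ) hm).indepFun hij
  simp only [(identDistrib_eval_infinitePi (γ := γ) hm _).variance_eq, Finset.sum_const,
    Finset.card_range, nsmul_eq_mul] at hV
  have hE : ∫ ω, (∑ k ∈ Finset.range (n + 1), fun ω : ℕ → E ↦ h (ω k)) ω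
      ∂(Measure.infinitePi fun _ : ℕ ↦ γ) = 0 := by
    simp only [Finset.sum_apply]
    rw [integral_finsetSum _ fun k _ ↦ (hLk k).integrable (by simp)]
    exact Finset.sum_eq_zero fun k _ ↦
      (identDistrib_eval_infinitePi (γ := γ) hm k).integral_eq.trans h0
  have hn : 0 < √(n + 1 : ℝ) := by positivity
  have hC := meas_ge_le_variance_div_sq hS (mul_pos hM0 hn)
  rw [hE, hV, mul_pow, Real.sq_sqrt (by positivity)] at hC
  refine le_trans (le_of_eq ?_) (hC.trans (le_trans (le_of_eq ?_) hM))
  · congr with ω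
    simp only [Finset.sum_apply, sub_zero, abs_mul, abs_inv, abs_of_pos hn]
    rw [← div_eq_inv_mul, le_div_iff₀ hn]
  · congr 1
    push_cast
    field_simp

end IID

/-- The law of infinitely many independent standard Gaussian vectors of `ℝ^p`. -/
noncomputable abbrev gaussianSeq (p : ℕ) : Measure (ℕ → Fin p → ℝ) :=
  Measure.infinitePi fun _ ↦ Measure.pi fun _ ↦ gaussianReal 0 1

/-- The normalized sums `(n + 1)^(-1/2) ∑ₖ (zₖ zₖᵀ - 1)`. -/
noncomputable def normalizedGram {p : ℕ} (i j : Fin p) (n : ℕ) (ω : ℕ → Fin p → ℝ) : ℝ :=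
  (√(n + 1 : ℝ))⁻¹ *
    ∑ k ∈ Finset.range (n + 1), (ω k i * ω k j - (1 : Matrix (Fin p) (Fin p) ℝ) i j)

/-- The normalized sums `(n + 1)^(-1/2) ∑ₖ zₖ`. -/
noncomputable def normalizedSum {p : ℕ} (i : Fin p) (n : ℕ) (ω : ℕ → Fin p → ℝ) : ℝ :=
  (√(n + 1 : ℝ))⁻¹ * ∑ k ∈ Finset.range (n + 1), ω k i

/-- The fluctuation `√n (Σ̂ - 1)` of the sample covariance matrix of a standard Gaussian sample. -/
noncomputable def sampleCovFluctuation {p : ℕ} (n : ℕ) (ω : ℕ → Fin p → ℝ) :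
    Fin p → Fin p → ℝ := fun i j ↦
  √(n + 1 : ℝ) / √n * normalizedGram i j n ω +
    (√n)⁻¹ * ((1 : Matrix (Fin p) (Fin p) ℝ) i j - normalizedSum i n ω * normalizedSum j n ω)

section Fluctuation

variable {p : ℕ}

lemma sampleCov_eq_one_add_fluctuation {n : ℕ} (hn : n ≠ 0) (ω : ℕ → Fin p → ℝ) :
    sampleCov (fun k : Fin (n + 1) ↦ ω k) =
      1 + Matrix.of ((√(n : ℝ))⁻¹ • sampleCovFluctuation n ω) := by
  ext i j
  have hn0 : (0 : ℝ) < n := by positivity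
  have h1 : (√(n : ℝ))⁻¹ * (√(n : ℝ))⁻¹ = 1 / n := by
    rw [← mul_inv, Real.mul_self_sqrt hn0.le, one_div]
  have h2 : √(n + 1 : ℝ) * √(n + 1 : ℝ) = n + 1 := Real.mul_self_sqrt (by positivity)
  have h3 : √(n + 1 : ℝ) * (√(n + 1 : ℝ))⁻¹ = 1 := mul_inv_cancel₀ (by positivity)
  have h4 : (√(n + 1 : ℝ))⁻¹ * (√(n + 1 : ℝ))⁻¹ = 1 / (n + 1) := by
    rw [← mul_inv, h2, one_div]
  rw [sampleCov_apply, Matrix.add_apply, Matrix.of_apply, Pi.smul_apply, Pi.smul_apply, smul_eq_mul]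
  simp only [sampleCovFluctuation, normalizedGram, normalizedSum, Finset.sum_sub_distrib,
    Finset.sum_const, Finset.card_range, nsmul_eq_mul]
  simp only [Fin.sum_univ_eq_sum_range (fun k ↦ ω k i * ω k j) (n + 1),
    Fin.sum_univ_eq_sum_range (fun k ↦ ω k i) (n + 1),
    Fin.sum_univ_eq_sum_range (fun k ↦ ω k j) (n + 1)]
  set q := ∑ k ∈ Finset.range (n + 1), ω k i * ω k j
  set a := ∑ k ∈ Finset.range (n + 1), ω k i
  set b := ∑ k ∈ Finset.range (n + 1), ω k j
  set d := (1 : Matrix (Fin p) (Fin p) ℝ) i j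
  have h5 : (√(n : ℝ))⁻¹ * (√(n + 1 : ℝ) / √n * ((√(n + 1 : ℝ))⁻¹ * (q - ((n + 1 : ℕ) : ℝ) * d)) +
      (√(n : ℝ))⁻¹ * (d - (√(n + 1 : ℝ))⁻¹ * a * ((√(n + 1 : ℝ))⁻¹ * b))) =
      (√(n : ℝ))⁻¹ * (√(n : ℝ))⁻¹ * ((√(n + 1 : ℝ) * (√(n + 1 : ℝ))⁻¹) *
        (q - ((n + 1 : ℕ) : ℝ) * d) + (d - (√(n + 1 : ℝ))⁻¹ * (√(n + 1 : ℝ))⁻¹ * (a * b))) := by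
    ring
  rw [h5, h1, h3, h4]
  push_cast
  field_simp
  ring

lemma boundedInProb_normalizedGram (i j : Fin p) :
    BoundedInProb (gaussianSeq p) (normalizedGram i j) := by
  refine boundedInProb_inv_sqrt_mul_sum
    (h := fun z : Fin p → ℝ ↦ z i * z j - (1 : Matrix (Fin p) (Fin p) ℝ) i j) (by fun_prop)
    ((memLp_eval_mul_eval_pi_gaussianReal i j).sub (memLp_const _)) ?_
  rw [integral_sub ((memLp_eval_mul_eval_pi_gaussianReal i j).integrable (by simp))
    (integrable_const _), integral_eval_mul_eval_pi_gaussianReal]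
  simp

lemma boundedInProb_normalizedSum (i : Fin p) :
    BoundedInProb (gaussianSeq p) (normalizedSum i) :=
  boundedInProb_inv_sqrt_mul_sum (h := fun z : Fin p → ℝ ↦ z i) (by fun_prop)
    (memLp_eval_pi_gaussianReal i (by simp)) (integral_eval_pi_gaussianReal i)

lemma tendsto_sqrt_succ_div_sqrt : Tendsto (fun n : ℕ ↦ √(n + 1 : ℝ) / √n) atTop (𝓝 1) := by
  have h : Tendsto (fun n : ℕ ↦ √(1 + 1 / (n : ℝ))) atTop (𝓝 √(1 + 0)) :=
    (tendsto_one_div_atTop_nhds_zero_nat.const_add 1).sqrt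
  rw [add_zero, Real.sqrt_one] at h
  refine h.congr' ?_
  filter_upwards [eventually_ne_atTop 0] with n hn
  have : (0 : ℝ) < n := by positivity
  rw [← Real.sqrt_div' _ this.le]
  congr 1
  field_simp

lemma boundedInProb_norm_sampleCovFluctuation :
    BoundedInProb (gaussianSeq p) fun n ω ↦ ‖sampleCovFluctuation n ω‖ := by
  have hinv (n : ℕ) : (√(n : ℝ))⁻¹ ≤ 1 := by
    rcases Nat.eq_zero_or_pos n with rfl | hn
    · simp
    · exact inv_le_one_of_one_le₀ (Real.one_le_sqrt.2 (by exact_mod_cast hn))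
  have hratio (n : ℕ) : √(n + 1 : ℝ) / √n ≤ 2 := by
    rcases Nat.eq_zero_or_pos n with rfl | hn
    · simp
    · have : (1 : ℝ) ≤ n := by exact_mod_cast hn
      refine div_le_of_le_mul₀ (by positivity) (by positivity) ?_
      rw [Real.sqrt_le_left (by positivity), mul_pow, Real.sq_sqrt (by positivity)]
      linarith
  have hentry (i j : Fin p) :
      BoundedInProb (gaussianSeq p) fun n ω ↦ |sampleCovFluctuation n ω i j| := by
    have h1 : BoundedInProb (gaussianSeq p) fun n (_ : ℕ → Fin p → ℝ) ↦ √(n + 1 : ℝ) / √n :=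
      boundedInProb_of_abs_le (C := 2) fun n _ ↦ by
        rw [abs_of_nonneg (by positivity)]; exact hratio n
    have h2 : BoundedInProb (gaussianSeq p) fun n (_ : ℕ → Fin p → ℝ) ↦ (√(n : ℝ))⁻¹ :=
      boundedInProb_of_abs_le (C := 1) fun n _ ↦ by
        rw [abs_of_nonneg (by positivity)]; exact hinv n
    have h3 : BoundedInProb (gaussianSeq p) fun (_ : ℕ) (_ : ℕ → Fin p → ℝ) ↦
        (1 : Matrix (Fin p) (Fin p) ℝ) i j := boundedInProb_of_abs_le fun _ _ ↦ le_rfl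
    have h4 : BoundedInProb (gaussianSeq p) fun (_ : ℕ) (_ : ℕ → Fin p → ℝ) ↦ (-1 : ℝ) :=
      boundedInProb_of_abs_le fun _ _ ↦ le_rfl
    refine ((h1.mul (boundedInProb_normalizedGram i j)).add (h2.mul (h3.add (h4.mul
      ((boundedInProb_normalizedSum i).mul (boundedInProb_normalizedSum j)))))).mono
      fun n ω ↦ le_of_eq ?_
    rw [abs_abs, sampleCovFluctuation]
    congr 1
    ring
  refine (BoundedInProb.sum Finset.univ fun i _ ↦ BoundedInProb.sum Finset.univ
    fun j _ ↦ hentry i j).mono fun n ω ↦ ?_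
  rw [abs_norm]
  refine le_trans ?_ (le_abs_self _)
  refine (pi_norm_le_iff_of_nonneg (by positivity)).2 fun i ↦
    (pi_norm_le_iff_of_nonneg (by positivity)).2 fun j ↦ ?_
  refine (Finset.single_le_sum (f := fun j ↦ |sampleCovFluctuation n ω i j|)
    (fun _ _ ↦ abs_nonneg _) (Finset.mem_univ j)).trans ?_
  exact Finset.single_le_sum (f := fun i ↦ ∑ j, |sampleCovFluctuation n ω i j|)
    (fun _ _ ↦ Finset.sum_nonneg fun _ _ ↦ abs_nonneg _) (Finset.mem_univ i)

/-- The trace of the normalized Gram matrix is asymptotically Gaussian. -/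
lemma tendstoInDistribution_trace_normalizedGram (hp : 1 ≤ p) :
    TendstoInDistribution (fun n ω ↦ (√(2 * p : ℝ))⁻¹ * ∑ i, normalizedGram i i n ω) atTop
      (id : ℝ → ℝ) (fun _ ↦ gaussianSeq p) (gaussianReal 0 1) := by
  set γ : Measure (Fin p → ℝ) := Measure.pi fun _ ↦ gaussianReal 0 1
  set h : (Fin p → ℝ) → ℝ := fun z ↦ (√(2 * p : ℝ))⁻¹ * (∑ i, z i ^ 2 - p)
  have hp0 : (0 : ℝ) < p := by exact_mod_cast hp
  have hm : Measurable h := by fun_prop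
  have hsq (i : Fin p) : MemLp (fun z : Fin p → ℝ ↦ z i ^ 2) 2 γ := by
    simpa only [sq] using memLp_eval_mul_eval_pi_gaussianReal i i
  have hmean : ∫ z, ∑ i : Fin p, z i ^ 2 ∂γ = p := by
    rw [integral_finsetSum _ fun i _ ↦ (hsq i).integrable (by simp)]
    simp [γ, integral_eval_sq_pi_gaussianReal]
  have hint : ∫ z, h z ∂γ = 0 := by
    simp only [h]
    rw [integral_const_mul, integral_sub ((memLp_finsetSum _ fun i _ ↦ hsq i).integrable (by simp))
      (integrable_const _), hmean]
    simp
  have hvar : ∫ z, h z ^ 2 ∂γ = 1 := by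
    have h1 := variance_eq_integral (μ := γ) (X := fun z : Fin p → ℝ ↦ ∑ i, z i ^ 2)
      (Measurable.aemeasurable (by fun_prop))
    rw [variance_sum_sq_pi_gaussianReal, hmean] at h1
    simp only [h, mul_pow]
    rw [integral_const_mul, ← h1, inv_pow, Real.sq_sqrt (by positivity)]
    field_simp
  have hid (k : ℕ) := identDistrib_eval_infinitePi (γ := γ) hm k
  have hclt := tendstoInDistribution_inv_sqrt_mul_sum (P := gaussianSeq p)
    (P' := gaussianReal 0 1) (Y := id) (X := fun k ω ↦ h (ω k)) HasLaw.id
    ((hid 0).integral_eq.trans hint)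
    (((hid 0).comp (u := fun x ↦ x ^ 2) (by fun_prop)).integral_eq.trans hvar)
    (iIndepFun_eval_infinitePi hm) fun k ↦ (hid k).trans (hid 0).symm
  have hclt' : TendstoInDistribution (fun n ω ↦ (√((n + 1 : ℕ) : ℝ))⁻¹ *
      ∑ k ∈ Finset.range (n + 1), h (ω k)) atTop (id : ℝ → ℝ) (fun _ ↦ gaussianSeq p)
      (gaussianReal 0 1) :=
    ⟨fun n ↦ hclt.forall_aemeasurable (n + 1), hclt.aemeasurable_limit,
      hclt.tendsto.comp (tendsto_add_atTop_nat 1)⟩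
  convert! hclt' using 3 with n ω
  simp only [normalizedGram, h, ← Finset.mul_sum, Matrix.one_apply_eq, Nat.cast_add, Nat.cast_one]
  rw [Finset.sum_comm]
  simp only [Finset.sum_sub_distrib, Finset.sum_const, Finset.card_univ, Fintype.card_fin, ← sq,
    nsmul_eq_mul, mul_one]
  ring

end Fluctuation

section Main

variable {p : ℕ}

/-- A sample of size `n + 1` from an affine image of the standard Gaussian law is the image of the
first `n + 1` terms of the standard Gaussian sequence. -/
lemma pi_map_affine_eq_map_gaussianSeq {q : ℕ} (f : (Fin p → ℝ) → Fin q → ℝ) (hf : Measurable f)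
    (n : ℕ) :
    (Measure.pi fun _ : Fin n ↦ (Measure.pi fun _ : Fin p ↦ gaussianReal 0 1).map f) =
      (gaussianSeq p).map fun ω (k : Fin n) ↦ f (ω k) := by
  have h : iIndepFun (fun (k : Fin n) (ω : ℕ → Fin p → ℝ) ↦ f (ω k)) (gaussianSeq p) :=
    (iIndepFun_infinitePi (X := fun _ : ℕ ↦ f) fun _ ↦ hf).precomp Fin.val_injective
  rw [h.map_fun_eq_pi_map fun k ↦ Measurable.aemeasurable (by fun_prop)]
  congr with k : 1
  rw [← (measurePreserving_eval_infinitePi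
    (fun _ : ℕ ↦ Measure.pi fun _ : Fin p ↦ gaussianReal 0 1) k).map_eq,
    Measure.map_map hf (by fun_prop)]
  rfl

@[fun_prop]
lemma measurable_det_sampleCov (n p : ℕ) :
    Measurable fun X : Fin (n + 1) → Fin p → ℝ ↦ (sampleCov X).det := by
  refine Continuous.measurable (Continuous.matrix_det (continuous_matrix fun i j ↦ ?_))
  simp only [sampleCov, Matrix.of_apply]
  fun_prop

/-- The centred and rescaled log determinant of the sample covariance matrix of a standard
Gaussian sample, relative to the covariance determinant `s`. -/
noncomputable def logDetStatistic (s : ℝ) (n : ℕ) (ω : ℕ → Fin p → ℝ) : ℝ :=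
  (Real.log (s * (sampleCov fun k : Fin (n + 1) ↦ ω k).det) - (p * (p + 1) : ℝ) / (2 * n) -
    Real.log s) / √(2 * p / n)

lemma measurable_logDetStatistic (s : ℝ) (n : ℕ) :
    Measurable (logDetStatistic s n : (ℕ → Fin p → ℝ) → ℝ) := by
  have h : Measurable fun ω : ℕ → Fin p → ℝ ↦ (sampleCov fun k : Fin (n + 1) ↦ ω k).det :=
    (measurable_det_sampleCov n p).comp (by fun_prop)
  unfold logDetStatistic
  fun_prop

lemma logDetStatistic_sub_trace (hp : 1 ≤ p) (s : ℝ) {n : ℕ} (hn : n ≠ 0)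
    (ω : ℕ → Fin p → ℝ) :
    logDetStatistic s n ω - (√(2 * p : ℝ))⁻¹ * ∑ i, normalizedGram i i n ω =
      √n * ((√(2 * p : ℝ))⁻¹ *
        (Real.log (s * (1 + Matrix.of ((√(n : ℝ))⁻¹ • sampleCovFluctuation n ω)).det) - Real.log s -
          ∑ i, ((√(n : ℝ))⁻¹ • sampleCovFluctuation n ω) i i)) +
      ((√(n + 1 : ℝ) / √n - 1) * ((√(2 * p : ℝ))⁻¹ * ∑ i, normalizedGram i i n ω) +
      (√(n : ℝ))⁻¹ * ((√(2 * p : ℝ))⁻¹ *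
        (p - (p * (p + 1) : ℝ) / 2 - ∑ i, normalizedSum i n ω * normalizedSum i n ω))) := by
  have hn0 : (0 : ℝ) < n := by positivity
  have hp0 : (0 : ℝ) < p := by exact_mod_cast hp
  rw [logDetStatistic, sampleCov_eq_one_add_fluctuation hn]
  have htr : ∑ i, ((√(n : ℝ))⁻¹ • sampleCovFluctuation n ω) i i =
      (√(n : ℝ))⁻¹ * (√(n + 1 : ℝ) / √n * ∑ i, normalizedGram i i n ω +
        (√(n : ℝ))⁻¹ * (p - ∑ i, normalizedSum i n ω * normalizedSum i n ω)) := by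
    simp [sampleCovFluctuation, Finset.mul_sum, Finset.sum_add_distrib, mul_add, mul_sub]
    ring
  rw [htr, Real.sqrt_div (by positivity)]
  set L := Real.log (s * (1 + Matrix.of ((√(n : ℝ))⁻¹ • sampleCovFluctuation n ω)).det)
  set g := ∑ i, normalizedGram i i n ω
  set t := ∑ i, normalizedSum i n ω * normalizedSum i n ω
  have hr : (√(n : ℝ)) ≠ 0 := by positivity
  have hr2 : (√(2 * p : ℝ)) ≠ 0 := by positivity
  have hsq : (n : ℝ) = √n ^ 2 := (Real.sq_sqrt hn0.le).symm
  set r := √(n : ℝ)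
  set r' := √(n + 1 : ℝ)
  set c := √(2 * p : ℝ)
  rw [hsq]
  field_simp
  ring

lemma tendstoInDistribution_logDetStatistic (hp : 1 ≤ p) {s : ℝ} (hs : 0 < s) :
    TendstoInDistribution (logDetStatistic s) atTop (id : ℝ → ℝ) (fun _ ↦ gaussianSeq p)
      (gaussianReal 0 1) := by
  refine tendstoInDistribution_of_tendstoInMeasure_sub _ _
    (tendstoInDistribution_trace_normalizedGram hp) ?_
    fun n ↦ (measurable_logDetStatistic s n).aemeasurable
  have hsqrt : Tendsto (fun n : ℕ ↦ √(n : ℝ)) atTop atTop :=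
    Real.tendsto_sqrt_atTop.comp tendsto_natCast_atTop_atTop
  have hconst (c : ℝ) : BoundedInProb (gaussianSeq p) fun (_ : ℕ) (_ : ℕ → Fin p → ℝ) ↦ c :=
    boundedInProb_of_abs_le fun _ _ ↦ le_rfl
  have h1 := tendstoInMeasure_remainder (boundedInProb_norm_sampleCovFluctuation (p := p))
    ((log_mul_det_isLittleO hs).const_mul_left (√(2 * p : ℝ))⁻¹) hsqrt
  have h2 := ((hconst (√(2 * p : ℝ))⁻¹).mul (BoundedInProb.sum Finset.univ fun i _ ↦
    boundedInProb_normalizedGram i i)).tendstoInMeasure_mul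
    (by simpa using tendsto_sqrt_succ_div_sqrt.sub_const 1)
  have h3 := ((hconst (√(2 * p : ℝ))⁻¹).mul ((hconst (p - (p * (p + 1) : ℝ) / 2)).add
    ((hconst (-1)).mul (BoundedInProb.sum Finset.univ fun i _ ↦
    (boundedInProb_normalizedSum i).mul (boundedInProb_normalizedSum i))))).tendstoInMeasure_mul
    hsqrt.inv_tendsto_atTop
  refine TendstoInMeasure.congr' ?_ .rfl
    (tendstoInMeasure_add_zero h1 (tendstoInMeasure_add_zero h2 h3))
  filter_upwards [eventually_ne_atTop 0] with n hn
  refine .of_forall fun ω ↦ ?_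
  simp only [Pi.sub_apply]
  rw [logDetStatistic_sub_trace hp s hn]
  simp only [Pi.inv_apply, neg_one_mul, ← sub_eq_add_neg]

end Main

end Auxiliary

/-- **CLT for the log determinant, fixed dimension (Corollary, Case (1))**: if the dimension `p`
is fixed, then `(log det Σ̂ − p(p+1)/(2n) − log det Σ)/√(2p/n) → N(0,1)` in distribution. -/
theorem log_det_sample_cov_clt_fixed_dim
    (p : ℕ) (hp1 : 1 ≤ p)
    (m : Fin p → ℝ)
    (S : Matrix (Fin p) (Fin p) ℝ) (hS : S.PosDef)
    (ν : Measure (Fin p → ℝ)) (hν : IsMvGaussian m S ν) :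
    ∀ x : ℝ,
      Tendsto
        (fun n =>
          ((Measure.pi fun _ : Fin (n + 1) => ν)
              {X : Fin (n + 1) → Fin p → ℝ |
                (Real.log (sampleCov X).det - (p * (p + 1) : ℝ) / (2 * n) - Real.log S.det) /
                    Real.sqrt (2 * p / n) ≤ x}).toReal)
        atTop (nhds (stdGaussianCDF x)) := by
  intro x
  obtain ⟨A, hA, rfl⟩ := hν.exists_eq_map hS.posSemidef
  have hlim := ProbabilityMeasure.tendsto_measure_of_null_frontier_of_tendsto'
    (tendstoInDistribution_logDetStatistic hp1 hS.det_pos).tendsto (E := Set.Iic x)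
    (by simpa using (nullSingletonClass_gaussianReal one_ne_zero).measure_singleton x)
  simp only [Measure.map_id, ProbabilityMeasure.coe_mk] at hlim
  refine ((ENNReal.tendsto_toReal (measure_ne_top _ _)).comp hlim).congr fun n ↦ ?_
  have hf : Measurable fun z : Fin p → ℝ ↦ m + A *ᵥ z :=
    Continuous.measurable (by fun_prop)
  rw [Function.comp_apply, pi_map_affine_eq_map_gaussianSeq _ hf,
    Measure.map_apply (measurable_logDetStatistic _ _) measurableSet_Iic,
    Measure.map_apply (by fun_prop) (measurableSet_le (by fun_prop) measurable_const)]
  congr 2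
  ext ω
  simp [logDetStatistic, det_sampleCov_affine hA fun k : Fin (n + 1) ↦ ω k]
end

section
/- Let Y = (y_{ij}) be an n × n random matrix whose entries y_{ij} are i.i.d. standard Gaussian N(0,1) random variables. Then (log |det Y| − (1/2) log (n−1)!)/√((1/2) log n) → N(0,1) in distribution as n → ∞. -/
open MeasureTheory ProbabilityTheory Filter Matrix

@[fun_prop]
lemma measurable_gammaPDF (a r : ℝ) : Measurable (gammaPDF a r) :=
  (measurable_gammaPDFReal a r).ennreal_ofReal

lemma integral_gammaMeasure {E : Type*} [NormedAddCommGroup E] [NormedSpace ℝ E]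
    {a r : ℝ} (ha : 0 < a) (hr : 0 < r) (f : ℝ → E) :
    ∫ x, f x ∂(gammaMeasure a r) =
      ∫ x in Set.Ioi 0, (r ^ a / Real.Gamma a * (x ^ (a - 1) * Real.exp (-(r * x)))) • f x := by
  rw [gammaMeasure, integral_withDensity_eq_integral_toReal_smul
    (measurable_gammaPDF a r) (by simp [gammaPDF]), ← integral_Ici_eq_integral_Ioi,
    ← integral_indicator measurableSet_Ici]
  refine integral_congr_ae (.of_forall fun x ↦ ?_)
  by_cases hx : 0 ≤ x
  · simp only [gammaPDF, ENNReal.toReal_ofReal (gammaPDFReal_nonneg ha hr x), Set.mem_Ici, hx,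
      Set.indicator_of_mem]
    simp [gammaPDFReal, hx, mul_assoc]
  · simp [gammaPDF, gammaPDFReal, hx]

lemma integral_rpow_gammaMeasure {a r p : ℝ} (ha : 0 < a) (hr : 0 < r) (hp : 0 < a + p) :
    ∫ x, (r * x) ^ p ∂(gammaMeasure a r) = Real.Gamma (a + p) / Real.Gamma a := by
  rw [integral_gammaMeasure ha hr]
  have key := Real.integral_rpow_mul_exp_neg_mul_Ioi hp hr
  have hG := (Real.Gamma_pos_of_pos ha).ne'
  calc _ = ∫ x in Set.Ioi (0 : ℝ), r ^ (a + p) / Real.Gamma a *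
        (x ^ (a + p - 1) * Real.exp (-(r * x))) := by
        refine setIntegral_congr_fun measurableSet_Ioi fun x hx ↦ ?_
        simp only [Set.mem_Ioi, smul_eq_mul] at hx ⊢
        rw [Real.mul_rpow hr.le hx.le, Real.rpow_add hr, show a + p - 1 = (a - 1) + p by ring,
          Real.rpow_add hx]
        ring
    _ = _ := by
        rw [integral_const_mul, key, one_div, Real.inv_rpow hr.le]
        field_simp

lemma ae_pos_gammaMeasure (a r : ℝ) : ∀ᵐ x ∂(gammaMeasure a r), 0 < x := by
  rw [gammaMeasure, ae_withDensity_iff (measurable_gammaPDF a r)]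
  filter_upwards [show ∀ᵐ x : ℝ, x ≠ 0 from by simp [ae_iff]] with x hx h
  by_contra! h0
  exact h (gammaPDF_of_neg (lt_of_le_of_ne h0 hx))

lemma integrable_rpow_gammaMeasure {a r p : ℝ} (ha : 0 < a) (hr : 0 < r) (hp : 0 < a + p) :
    Integrable (fun x ↦ (r * x) ^ p) (gammaMeasure a r) :=
  .of_integral_ne_zero <| by
    rw [integral_rpow_gammaMeasure ha hr hp]
    exact (div_pos (Real.Gamma_pos_of_pos hp) (Real.Gamma_pos_of_pos ha)).ne'

lemma integral_poly_add_inv_gammaMeasure {a r : ℝ} (ha : 1 < a) (hr : 0 < r)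
    (c : Fin 5 → ℝ) (d : ℝ) :
    Integrable (fun x ↦ ∑ i, c i * (r * x / a) ^ (i : ℕ) + d * (r * x / a)⁻¹) (gammaMeasure a r) ∧
    ∫ x, (∑ i, c i * (r * x / a) ^ (i : ℕ) + d * (r * x / a)⁻¹) ∂(gammaMeasure a r) =
      c 0 + c 1 + c 2 * ((a + 1) / a) + c 3 * ((a + 1) * (a + 2) / a ^ 2) +
      c 4 * ((a + 1) * (a + 2) * (a + 3) / a ^ 3) + d * (a / (a - 1)) := by
  have ha0 : 0 < a := by linarith
  have hG := (Real.Gamma_pos_of_pos ha0).ne'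
  have hpow (i : Fin 5) : Integrable (fun x ↦ c i * (r * x / a) ^ (i : ℕ)) (gammaMeasure a r) := by
    have := integrable_rpow_gammaMeasure (p := ((i : ℕ) : ℝ)) ha0 hr (by positivity)
    simp only [Real.rpow_natCast] at this
    simp only [div_pow]
    exact (this.div_const _).const_mul _
  have hinv : Integrable (fun x ↦ d * (r * x / a)⁻¹) (gammaMeasure a r) := by
    have := integrable_rpow_gammaMeasure (p := -1) ha0 hr (by linarith)
    simp only [Real.rpow_neg_one] at this
    have e : (fun x ↦ d * (r * x / a)⁻¹) = fun x ↦ d * (a * (r * x)⁻¹) := by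
      funext x
      rw [inv_div, div_eq_mul_inv]
    rw [e]
    exact (this.const_mul a).const_mul d
  have ipow (i : ℕ) : ∫ x, (r * x / a) ^ i ∂(gammaMeasure a r) =
      Real.Gamma (a + i) / Real.Gamma a / a ^ i := by
    have := integral_rpow_gammaMeasure (p := (i : ℝ)) ha0 hr (by positivity)
    simp only [Real.rpow_natCast] at this
    simp only [div_pow]
    rw [integral_div, this]
  have iinv : ∫ x, (r * x / a)⁻¹ ∂(gammaMeasure a r) = a / (a - 1) := by
    have := integral_rpow_gammaMeasure (p := -1) ha0 hr (by linarith)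
    simp only [Real.rpow_neg_one] at this
    simp only [inv_div, div_eq_mul_inv a]
    rw [integral_const_mul, this, ← sub_eq_add_neg]
    have h1 : a - 1 ≠ 0 := by linarith
    have h2 := Real.Gamma_add_one h1
    rw [sub_add_cancel] at h2
    rw [h2]
    have : Real.Gamma (a - 1) ≠ 0 := (Real.Gamma_pos_of_pos (by linarith)).ne'
    field_simp
  have g1 : Real.Gamma (a + 1) = a * Real.Gamma a := Real.Gamma_add_one (by linarith)
  have g2 : Real.Gamma (a + 2) = (a + 1) * (a * Real.Gamma a) := by
    rw [← g1, ← Real.Gamma_add_one (by linarith)]; ring_nf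
  have g3 : Real.Gamma (a + 3) = (a + 2) * ((a + 1) * (a * Real.Gamma a)) := by
    rw [← g2, ← Real.Gamma_add_one (by linarith)]; ring_nf
  have g4 : Real.Gamma (a + 4) = (a + 3) * ((a + 2) * ((a + 1) * (a * Real.Gamma a))) := by
    rw [← g3, ← Real.Gamma_add_one (by linarith)]; ring_nf
  refine ⟨(integrable_finsetSum _ fun i _ ↦ hpow i).add hinv, ?_⟩
  rw [integral_add (integrable_finsetSum _ fun i _ ↦ hpow i) hinv,
    integral_finsetSum _ fun i _ ↦ hpow i]
  simp only [integral_const_mul, ipow, iinv, Fin.sum_univ_five]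
  simp only [Fin.isValue, Fin.coe_ofNat_eq_mod, Nat.reduceMod, Nat.cast_zero, Nat.cast_one,
    Nat.cast_ofNat, add_zero, g1, g2, g3, g4]
  field_simp

lemma integral_abs_cube_gammaMeasure_le {a r : ℝ} (ha : 3 / 2 ≤ a) (hr : 0 < r) :
    Integrable (fun x ↦ |r * x / a - 1| ^ 3 * (1 + (r * x / a)⁻¹)) (gammaMeasure a r) ∧
    ∫ x, |r * x / a - 1| ^ 3 * (1 + (r * x / a)⁻¹) ∂(gammaMeasure a r) ≤
      8 * (a * √a)⁻¹ := by
  have ha0 : 0 < a := by linarith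
  have hb : 0 < √a := Real.sqrt_pos.2 ha0
  obtain ⟨h2, i2⟩ := integral_poly_add_inv_gammaMeasure (a := a) (r := r) (by linarith) hr
    ![-1, -1, 1, 0, 0] 1
  obtain ⟨h4, i4⟩ := integral_poly_add_inv_gammaMeasure (a := a) (r := r) (by linarith) hr
    ![-3, 2, 2, -3, 1] 1
  set P : ℝ → ℝ := fun x ↦ ∑ i : Fin 5, ![-1, -1, 1, 0, 0] i * (r * x / a) ^ (i : ℕ) +
    1 * (r * x / a)⁻¹ with hP
  set R : ℝ → ℝ := fun x ↦ ∑ i : Fin 5, ![-3, 2, 2, -3, 1] i * (r * x / a) ^ (i : ℕ) +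
    1 * (r * x / a)⁻¹ with hR
  have h_integrable : Integrable (fun x ↦ 1 / 2 * ((√a)⁻¹ * P x + √a * R x)) (gammaMeasure a r) :=
    ((h2.const_mul (√a)⁻¹).add (h4.const_mul √a)).const_mul (1 / 2)
  have hle : ∀ᵐ x ∂(gammaMeasure a r), |r * x / a - 1| ^ 3 * (1 + (r * x / a)⁻¹) ≤
      1 / 2 * ((√a)⁻¹ * P x + √a * R x) := by
    filter_upwards [ae_pos_gammaMeasure a r] with x hx
    have hu : 0 < r * x / a := by positivity
    set u := r * x / a with hu'
    have hamgm : |u - 1| ^ 3 ≤ 1 / 2 * ((√a)⁻¹ * (u - 1) ^ 2 + √a * (u - 1) ^ 4) := by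
      have h := mul_nonneg (mul_nonneg (sq_nonneg (u - 1)) (inv_pos.2 hb).le)
        (sq_nonneg (1 - √a * |u - 1|))
      have hs : |u - 1| ^ 2 = (u - 1) ^ 2 := sq_abs _
      have hs4 : |u - 1| ^ 4 = (u - 1) ^ 4 := by
        rw [show (4 : ℕ) = 2 * 2 from rfl, pow_mul, hs, ← pow_mul]
      rw [← hs, ← hs4]
      rw [← hs] at h
      have : |u - 1| ^ 2 * (√a)⁻¹ * (1 - √a * |u - 1|) ^ 2 =
        (√a)⁻¹ * |u - 1| ^ 2 - 2 * |u - 1| ^ 3 + √a * |u - 1| ^ 4 := by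
        field_simp
        ring
      linarith
    calc _ ≤ (1 / 2 * ((√a)⁻¹ * (u - 1) ^ 2 + √a * (u - 1) ^ 4)) * (1 + u⁻¹) :=
          mul_le_mul_of_nonneg_right hamgm (by positivity)
      _ = _ := by
        have eP (u : ℝ) : ∑ i : Fin 5, ![-1, -1, 1, 0, 0] i * u ^ (i : ℕ) + 1 * u⁻¹ =
            u ^ 2 - u - 1 + u⁻¹ := by
          simp [Fin.sum_univ_five]
          ring
        have eR (u : ℝ) : ∑ i : Fin 5, ![-3, 2, 2, -3, 1] i * u ^ (i : ℕ) + 1 * u⁻¹ =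
            u ^ 4 - 3 * u ^ 3 + 2 * u ^ 2 + 2 * u - 3 + u⁻¹ := by
          simp [Fin.sum_univ_five]
          ring
        simp only [hP, hR, eP, eR, ← hu']
        clear_value u
        field_simp
        ring
  have hnn : ∀ᵐ x ∂(gammaMeasure a r), 0 ≤ |r * x / a - 1| ^ 3 * (1 + (r * x / a)⁻¹) := by
    filter_upwards [ae_pos_gammaMeasure a r] with x hx
    positivity
  refine ⟨h_integrable.mono' (by fun_prop) ?_, ?_⟩
  · filter_upwards [hle, hnn] with x hx hx'
    rwa [Real.norm_of_nonneg hx']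
  · refine (integral_mono_of_nonneg hnn h_integrable hle).trans ?_
    rw [integral_const_mul, integral_add (h2.const_mul _) (h4.const_mul _), integral_const_mul,
      integral_const_mul, i2, i4]
    have ha1 : 1 / (a - 1) ≤ 3 / a := by
      rw [div_le_div_iff₀ (by linarith) ha0]; linarith
    have e2 : (-1 : ℝ) + -1 + 1 * ((a + 1) / a) + 0 * ((a + 1) * (a + 2) / a ^ 2) +
        0 * ((a + 1) * (a + 2) * (a + 3) / a ^ 3) + 1 * (a / (a - 1)) ≤ 4 / a := by
      have : (a - 1) ≠ 0 := by linarith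
      have e : a / (a - 1) = 1 + 1 / (a - 1) := by field_simp; ring
      rw [e]
      have e' : (a + 1) / a = 1 + 1 / a := by field_simp
      rw [e']
      have : 4 / a = 1 / a + 3 / a := by ring
      linarith
    have e4 : (-3 : ℝ) + 2 + 2 * ((a + 1) / a) + -3 * ((a + 1) * (a + 2) / a ^ 2) +
        1 * ((a + 1) * (a + 2) * (a + 3) / a ^ 3) + 1 * (a / (a - 1)) ≤ 12 / a ^ 2 := by
      have h1 : (a - 1) ≠ 0 := by linarith
      have e : (-3 : ℝ) + 2 + 2 * ((a + 1) / a) + -3 * ((a + 1) * (a + 2) / a ^ 2) +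
        1 * ((a + 1) * (a + 2) * (a + 3) / a ^ 3) + 1 * (a / (a - 1)) =
          (3 * a + 6) / a ^ 3 + 2 / a ^ 2 + 1 / a * (1 / (a - 1)) := by
        field_simp
        ring
      rw [e]
      have h2 : 1 / a * (1 / (a - 1)) ≤ 3 / a ^ 2 := by
        calc _ ≤ 1 / a * (3 / a) := by gcongr
          _ = _ := by field_simp
      have h3 : (3 * a + 6) / a ^ 3 ≤ 7 / a ^ 2 := by
        rw [div_le_div_iff₀ (by positivity) (by positivity)]
        have : 0 ≤ a ^ 2 * (4 * a - 6) := by apply mul_nonneg <;> [positivity; linarith]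
        nlinarith
      have : 12 / a ^ 2 = 7 / a ^ 2 + 2 / a ^ 2 + 3 / a ^ 2 := by ring
      linarith
    have hsq : √a * √a = a := Real.mul_self_sqrt ha0.le
    calc _ ≤ 1 / 2 * ((√a)⁻¹ * (4 / a) + √a * (12 / a ^ 2)) := by
          gcongr
          · simpa using e2
          · simpa using e4
      _ = _ := by
          field_simp
          nlinarith

lemma Complex.norm_exp_mul_log_sub_taylor_le {s u : ℝ} (hs : |s| ≤ 1) (hu : 0 < u) :
    ‖Complex.exp (Complex.I * s * Real.log u) - (1 + Complex.I * s * (u - 1 : ℝ) +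
      Complex.I * s * (Complex.I * s - 1) / 2 * ((u - 1) ^ 2 : ℝ))‖ ≤
      48 * (|u - 1| ^ 3 * (1 + u⁻¹)) := by
  set c : ℂ := Complex.I * s with hc
  have hcn : ‖c‖ ≤ 1 := by simpa [hc] using hs
  have hc1 : ‖c - 1‖ ≤ 2 := (norm_sub_le _ _).trans (by norm_num; linarith)
  have hc2 : ‖c - 2‖ ≤ 3 := (norm_sub_le _ _).trans (by norm_num; linarith)
  have hcre : c.re = 0 := by simp [hc]
  obtain hu2 | hu2 := lt_or_ge u (1 / 2)
  · have h1 : ‖Complex.exp (c * Real.log u)‖ = 1 := by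
      rw [hc, mul_assoc, mul_comm, ← Complex.ofReal_mul, Complex.norm_exp_ofReal_mul_I]
    have habs : |u - 1| = 1 - u := by rw [abs_of_nonpos (by linarith)]; ring
    have h2 : ‖c * (u - 1 : ℝ)‖ ≤ 1 := by
      rw [norm_mul, Complex.norm_real, Real.norm_eq_abs]
      exact mul_le_one₀ hcn (abs_nonneg _) (by rw [habs]; linarith)
    have h3 : ‖c * (c - 1) / 2 * ((u - 1) ^ 2 : ℝ)‖ ≤ 1 := by
      rw [norm_mul, Complex.norm_real, Real.norm_eq_abs, norm_div, norm_mul, abs_pow, habs]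
      refine mul_le_one₀ ?_ (by positivity) (pow_le_one₀ (by linarith) (by linarith))
      rw [Complex.norm_ofNat, div_le_one (by norm_num)]
      nlinarith [norm_nonneg c, norm_nonneg (c - 1)]
    have h4 : (1 / 2 : ℝ) ^ 3 * (1 + 2) ≤ |u - 1| ^ 3 * (1 + u⁻¹) := by
      rw [habs]
      have h5 : 2 ≤ u⁻¹ := by rw [le_inv_comm₀ (by norm_num) hu]; linarith
      exact mul_le_mul (pow_le_pow_left₀ (by norm_num) (by linarith) 3) (by linarith)
        (by norm_num) (pow_nonneg (by linarith) 3)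
    calc _ ≤ ‖Complex.exp (c * Real.log u)‖ + (‖(1 : ℂ)‖ + ‖c * (u - 1 : ℝ)‖ +
          ‖c * (c - 1) / 2 * ((u - 1) ^ 2 : ℝ)‖) :=
          (norm_sub_le _ _).trans (by gcongr; exact norm_add₃_le)
      _ ≤ _ := by rw [h1, norm_one]; linarith
  have hseg (v : ℝ) (hv : v ∈ Set.uIcc 1 u) : 1 / 2 ≤ v ∧ |v - 1| ≤ |u - 1| :=
    ⟨(le_min (by norm_num) hu2).trans hv.1, Set.abs_sub_left_of_mem_uIcc hv⟩
  have hderiv (b : ℂ) (v : ℝ) (hv : v ∈ Set.uIcc 1 u) :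
      HasDerivAt (fun v : ℝ ↦ Complex.exp (b * Real.log v))
        (b * Complex.exp ((b - 1) * Real.log v)) v := by
    have hv0 : 0 < v := by linarith [(hseg v hv).1]
    have := (((Real.hasDerivAt_log hv0.ne').ofReal_comp).const_mul b).cexp
    convert! this using 1
    rw [sub_mul, Complex.exp_sub, one_mul, ← Complex.ofReal_exp, Real.exp_log hv0]
    push_cast
    ring
  have hlin (v : ℝ) : HasDerivAt (fun v : ℝ ↦ ((v - 1 : ℝ) : ℂ)) 1 v := by
    simpa using ((hasDerivAt_id v).sub_const 1).ofReal_comp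
  have hsq (v : ℝ) : HasDerivAt (fun v : ℝ ↦ (((v - 1) ^ 2 : ℝ) : ℂ)) (2 * (v - 1 : ℝ)) v := by
    have := (((hasDerivAt_id v).sub_const 1).pow 2).ofReal_comp
    simpa using this
  have hmv {f f' : ℝ → ℂ} {K : ℝ} (hf : ∀ v ∈ Set.uIcc 1 u, HasDerivAt f (f' v) v)
      (hK : ∀ v ∈ Set.uIcc 1 u, ‖f' v‖ ≤ K) (v : ℝ) (hv : v ∈ Set.uIcc 1 u) :
      ‖f v - f 1‖ ≤ K * |u - 1| := by
    have hK0 : 0 ≤ K := (norm_nonneg _).trans (hK 1 Set.left_mem_uIcc)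
    refine ((convex_uIcc 1 u).norm_image_sub_le_of_norm_hasDerivWithin_le
      (fun v hv ↦ (hf v hv).hasDerivWithinAt) hK Set.left_mem_uIcc hv).trans ?_
    gcongr
    exact (hseg v hv).2
  have hb3 (v : ℝ) (hv : v ∈ Set.uIcc 1 u) :
      ‖c * ((c - 1) * ((c - 2) * Complex.exp ((c - 3) * Real.log v)))‖ ≤ 48 := by
    have hv2 := (hseg v hv).1
    have hexp : ‖Complex.exp ((c - 3) * Real.log v)‖ ≤ 8 := by
      rw [Complex.norm_exp, Complex.re_mul_ofReal, Complex.sub_re, hcre,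
        show (0 - (3 : ℂ).re) * Real.log v = Real.log (v⁻¹ ^ 3) by
          rw [Real.log_pow, Real.log_inv]; norm_num, Real.exp_log (by positivity)]
      calc v⁻¹ ^ 3 ≤ (2 : ℝ) ^ 3 := by
            gcongr
            rw [inv_le_comm₀ (by linarith) (by norm_num)]; linarith
        _ = 8 := by norm_num
    simp only [norm_mul]
    calc _ ≤ (1 : ℝ) * (2 * (3 * 8)) := by gcongr
      _ = 48 := by norm_num
  have hb2 (v : ℝ) (hv : v ∈ Set.uIcc 1 u) :
      ‖c * ((c - 1) * Complex.exp ((c - 2) * Real.log v)) - c * (c - 1)‖ ≤ 48 * |u - 1| := by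
    have := hmv (f := fun v ↦ c * ((c - 1) * Complex.exp ((c - 2) * Real.log v)))
      (fun v hv ↦ ((hderiv (c - 2) v hv).const_mul (c - 1)).const_mul c)
      (K := 48) (fun v hv ↦ by
        have := hb3 v hv
        rwa [show c - 3 = c - 2 - 1 by ring] at this) v hv
    simpa using this
  have hb1 (v : ℝ) (hv : v ∈ Set.uIcc 1 u) :
      ‖c * Complex.exp ((c - 1) * Real.log v) - c - c * (c - 1) * (v - 1 : ℝ)‖ ≤
        48 * |u - 1| * |u - 1| := by
    have := hmv (f := fun v ↦ c * Complex.exp ((c - 1) * Real.log v) - c * (c - 1) * (v - 1 : ℝ))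
      (fun v hv ↦ ((hderiv (c - 1) v hv).const_mul c).sub ((hlin v).const_mul (c * (c - 1))))
      (K := 48 * |u - 1|) (fun v hv ↦ by
        have := hb2 v hv
        rwa [mul_one, show c - 1 - 1 = c - 2 by ring]) v hv
    refine le_of_eq_of_le ?_ this
    congr 1
    simp
    ring
  have := hmv (f := fun v ↦ Complex.exp (c * Real.log v) - c * (v - 1 : ℝ) -
      c * (c - 1) / 2 * ((v - 1) ^ 2 : ℝ))
    (fun v hv ↦ ((hderiv c v hv).sub ((hlin v).const_mul c)).sub
      ((hsq v).const_mul (c * (c - 1) / 2)))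
    (K := 48 * |u - 1| * |u - 1|) (fun v hv ↦ by
      refine le_of_eq_of_le ?_ (hb1 v hv)
      congr 1
      ring) u Set.right_mem_uIcc
  calc _ ≤ 48 * |u - 1| * |u - 1| * |u - 1| := by
        refine le_of_eq_of_le ?_ this
        congr 1
        simp
        ring
    _ = 48 * (|u - 1| ^ 3 * 1) := by ring
    _ ≤ _ := by
        gcongr
        simpa using hu.le

lemma norm_integral_exp_log_gammaMeasure_sub_le {a r s : ℝ} (ha : 3 / 2 ≤ a) (hr : 0 < r)
    (hs : |s| ≤ 1) :
    ‖∫ x, Complex.exp (Complex.I * s * Real.log (r * x / a)) ∂(gammaMeasure a r) -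
      (1 - (s ^ 2 + Complex.I * s) / (2 * a))‖ ≤ 384 * (a * √a)⁻¹ := by
  have ha0 : 0 < a := by linarith
  have : IsProbabilityMeasure (gammaMeasure a r) := isProbabilityMeasure_gammaMeasure ha0 hr
  obtain ⟨h1, i1⟩ := integral_poly_add_inv_gammaMeasure (a := a) (r := r) (by linarith) hr
    ![-1, 1, 0, 0, 0] 0
  obtain ⟨h2, i2⟩ := integral_poly_add_inv_gammaMeasure (a := a) (r := r) (by linarith) hr
    ![1, -2, 1, 0, 0] 0
  have e1 (u : ℝ) : ∑ i : Fin 5, ![-1, 1, 0, 0, 0] i * u ^ (i : ℕ) + 0 * u⁻¹ = u - 1 := by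
    simp [Fin.sum_univ_five]
    ring
  have e2 (u : ℝ) : ∑ i : Fin 5, ![1, -2, 1, 0, 0] i * u ^ (i : ℕ) + 0 * u⁻¹ = (u - 1) ^ 2 := by
    simp [Fin.sum_univ_five]
    ring
  simp only [e1] at h1 i1
  simp only [e2] at h2 i2
  have i1' : ∫ x, (r * x / a - 1) ∂(gammaMeasure a r) = 0 := by
    rw [i1]; simp
  have i2' : ∫ x, (r * x / a - 1) ^ 2 ∂(gammaMeasure a r) = 1 / a := by
    rw [i2]; simp; field_simp; ring
  set c : ℂ := Complex.I * s with hc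
  have hw : Integrable (fun x ↦ c * ((r * x / a - 1 : ℝ) : ℂ)) (gammaMeasure a r) :=
    h1.ofReal.const_mul c
  have hint1 : Integrable (fun x ↦ 1 + c * (r * x / a - 1 : ℝ)) (gammaMeasure a r) :=
    (integrable_const _).add hw
  have hint2 : Integrable (fun x ↦ c * (c - 1) / 2 * ((r * x / a - 1) ^ 2 : ℝ))
      (gammaMeasure a r) := h2.ofReal.const_mul _
  have hmain : ∫ x, (1 + c * (r * x / a - 1 : ℝ) + c * (c - 1) / 2 * ((r * x / a - 1) ^ 2 : ℝ))
      ∂(gammaMeasure a r) = 1 - (s ^ 2 + c) / (2 * a) := by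
    rw [integral_add hint1 hint2, integral_add (integrable_const _) hw,
      integral_const_mul, integral_const_mul, integral_complex_ofReal, integral_complex_ofReal,
      i1', i2']
    have hcc : c * (c - 1) = -(s ^ 2 + c) := by
      have : c * c = -s ^ 2 := by
        rw [hc]; linear_combination (s : ℂ) ^ 2 * Complex.I_mul_I
      linear_combination this
    have : (a : ℂ) ≠ 0 := by exact_mod_cast ha0.ne'
    rw [hcc]
    simp
    field_simp
    ring
  have hexp : Integrable (fun x ↦ Complex.exp (c * Real.log (r * x / a))) (gammaMeasure a r) := by
    refine Integrable.of_bound (C := 1)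
      (Measurable.aestronglyMeasurable (by fun_prop)) (.of_forall fun x ↦ ?_)
    rw [hc, mul_assoc, mul_comm, ← Complex.ofReal_mul, Complex.norm_exp_ofReal_mul_I]
  obtain ⟨h3, i3⟩ := integral_abs_cube_gammaMeasure_le ha hr
  have h_integrable : Integrable (fun x ↦ 1 + c * ((r * x / a - 1 : ℝ) : ℂ) +
      c * (c - 1) / 2 * (((r * x / a - 1) ^ 2 : ℝ) : ℂ)) (gammaMeasure a r) := hint1.add hint2
  rw [← hmain, ← integral_sub hexp h_integrable]
  calc _ ≤ ∫ x, 48 * (|r * x / a - 1| ^ 3 * (1 + (r * x / a)⁻¹)) ∂(gammaMeasure a r) := by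
        refine norm_integral_le_of_norm_le (h3.const_mul _) ?_
        filter_upwards [ae_pos_gammaMeasure a r] with x hx
        exact Complex.norm_exp_mul_log_sub_taylor_le hs (by positivity)
    _ ≤ _ := by
        rw [integral_const_mul]
        linarith

lemma norm_prod_sub_prod_le_sum {ι R : Type*} [NormedCommRing R] [NormOneClass R] (s : Finset ι)
    {f g : ι → R} (hf : ∀ i ∈ s, ‖f i‖ ≤ 1) (hg : ∀ i ∈ s, ‖g i‖ ≤ 1) :
    ‖∏ i ∈ s, f i - ∏ i ∈ s, g i‖ ≤ ∑ i ∈ s, ‖f i - g i‖ := by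
  classical
  induction s using Finset.induction_on with
  | empty => simp
  | insert a s ha ih =>
    simp only [Finset.mem_insert, forall_eq_or_imp] at hf hg
    rw [Finset.prod_insert ha, Finset.prod_insert ha, Finset.sum_insert ha]
    have hp : ‖∏ i ∈ s, f i‖ ≤ 1 :=
      (Finset.norm_prod_le _ _).trans (Finset.prod_le_one (fun _ _ ↦ norm_nonneg _) hf.2)
    calc _ = ‖(f a - g a) * ∏ i ∈ s, f i + g a * (∏ i ∈ s, f i - ∏ i ∈ s, g i)‖ := by
          congr 1; ring
      _ ≤ ‖f a - g a‖ * ‖∏ i ∈ s, f i‖ + ‖g a‖ * ‖∏ i ∈ s, f i - ∏ i ∈ s, g i‖ :=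
          (norm_add_le _ _).trans (add_le_add (norm_mul_le _ _) (norm_mul_le _ _))
      _ ≤ ‖f a - g a‖ * 1 + 1 * ∑ i ∈ s, ‖f i - g i‖ := by
          gcongr
          · exact hg.1
          · exact ih hf.2 hg.2
      _ = _ := by ring

lemma Complex.norm_exp_I_mul_mul_ofReal (s x : ℝ) : ‖Complex.exp (Complex.I * s * x)‖ = 1 := by
  rw [mul_assoc, mul_comm, ← Complex.ofReal_mul, Complex.norm_exp_ofReal_mul_I]

/-- The characteristic function of the logarithm of a `χ²` variable with `k` degrees of freedom
divided by `k`. -/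
noncomputable def chiSqLogCharFun (k : ℕ) (s : ℝ) : ℂ :=
  ∫ x, Complex.exp (Complex.I * s * Real.log (1 / 2 * x / (k / 2))) ∂(gammaMeasure (k / 2) (1 / 2))

lemma norm_chiSqLogCharFun_le {k : ℕ} (hk : 0 < k) (s : ℝ) : ‖chiSqLogCharFun k s‖ ≤ 1 := by
  have : IsProbabilityMeasure (gammaMeasure ((k : ℝ) / 2) (1 / 2)) :=
    isProbabilityMeasure_gammaMeasure (by positivity) (by positivity)
  refine (norm_integral_le_integral_norm _).trans ?_
  simp only [Complex.norm_exp_I_mul_mul_ofReal]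
  rw [integral_const, probReal_univ, one_smul]

lemma tendsto_chiSqLogCharFun {k : ℕ} (hk : 0 < k) :
    Tendsto (chiSqLogCharFun k) (nhds 0) (nhds 1) := by
  have : IsProbabilityMeasure (gammaMeasure ((k : ℝ) / 2) (1 / 2)) :=
    isProbabilityMeasure_gammaMeasure (by positivity) (by positivity)
  have hcont : Continuous (chiSqLogCharFun k) := by
    refine continuous_of_dominated (bound := fun _ ↦ 1)
      (fun s ↦ Measurable.aestronglyMeasurable (by fun_prop))
      (fun s ↦ .of_forall fun x ↦ (Complex.norm_exp_I_mul_mul_ofReal s _).le)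
      (integrable_const _) (.of_forall fun x ↦ by fun_prop)
  have h0 : chiSqLogCharFun k 0 = 1 := by
    simp only [chiSqLogCharFun, Complex.ofReal_zero, mul_zero, zero_mul, Complex.exp_zero]
    rw [integral_const, probReal_univ, one_smul]
  exact h0 ▸ hcont.tendsto 0

lemma norm_exp_neg_div_le (s : ℝ) (k : ℕ) :
    ‖Complex.exp (-((s ^ 2 + Complex.I * s) / k))‖ ≤ 1 := by
  rw [Complex.norm_exp, Real.exp_le_one_iff, ← Complex.ofReal_natCast, Complex.neg_re,
    Complex.div_ofReal_re]
  have : ((s : ℂ) ^ 2 + Complex.I * s).re = s ^ 2 := by simp [← Complex.ofReal_pow]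
  rw [this, neg_nonpos]
  positivity

lemma norm_chiSqLogCharFun_sub_exp_le {k : ℕ} (hk : 0 < k) {s : ℝ} (hs : |s| ≤ 1) :
    ‖chiSqLogCharFun k s - Complex.exp (-((s ^ 2 + Complex.I * s) / k))‖ ≤
      2000 * (k * √k)⁻¹ := by
  obtain hk3 | hk3 := lt_or_ge k 3
  · have h2 : (k : ℝ) ≤ 2 := by exact_mod_cast Nat.lt_succ_iff.1 hk3
    have hk0 : (0 : ℝ) < k := by exact_mod_cast hk
    have h3 : √(k : ℝ) ≤ 2 := Real.sqrt_le_iff.2 ⟨by norm_num, by linarith⟩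
    have h4 : 2 ≤ 2000 * (k * √k : ℝ)⁻¹ := by
      rw [← div_eq_mul_inv, le_div_iff₀ (by positivity)]
      nlinarith
    refine (norm_sub_le _ _).trans ?_
    linarith [norm_chiSqLogCharFun_le hk s, norm_exp_neg_div_le s k]
  · have hk0 : (3 : ℝ) ≤ k := by exact_mod_cast hk3
    have hA := norm_integral_exp_log_gammaMeasure_sub_le (a := k / 2) (r := 1 / 2)
      (by linarith) (by norm_num) hs
    have hz : ‖(s ^ 2 + Complex.I * s) / k‖ ≤ 2 / k := by
      rw [norm_div, Complex.norm_natCast]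
      gcongr
      refine (norm_add_le _ _).trans ?_
      simp only [norm_pow, Complex.norm_real, norm_mul, Complex.norm_I, one_mul, Real.norm_eq_abs]
      nlinarith [abs_nonneg s]
    set z : ℂ := (s ^ 2 + Complex.I * s) / k with hzdef
    have hE : ‖Complex.exp (-z) - 1 - (-z)‖ ≤ (2 / k) ^ 2 := by
      have h1 : ‖-z‖ ≤ 1 := by
        rw [norm_neg]
        refine hz.trans ?_
        rw [div_le_one (by linarith)]
        linarith
      refine (Complex.norm_exp_sub_one_sub_id_le h1).trans ?_
      rw [norm_neg]
      gcongr
    have hzA : (s ^ 2 + Complex.I * s) / (2 * ((k / 2 : ℝ) : ℂ)) = z := by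
      rw [hzdef]
      push_cast
      congr 1
      ring
    rw [hzA] at hA
    have hs1 : (1 : ℝ) ≤ √k := Real.one_le_sqrt.2 (by linarith)
    have hsq : √(k : ℝ) * √k = k := Real.mul_self_sqrt (by linarith)
    have b1 : ((k : ℝ) / 2 * √(k / 2))⁻¹ ≤ 4 * (k * √k)⁻¹ := by
      have : √(k : ℝ) / 2 ≤ √(k / 2) := by
        rw [Real.le_sqrt (by positivity) (by positivity), div_pow, Real.sq_sqrt (by positivity)]
        linarith
      rw [← div_eq_mul_inv, inv_le_comm₀ (by positivity) (by positivity), inv_div]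
      calc _ = (k : ℝ) / 2 * (√k / 2) := by ring
        _ ≤ _ := by gcongr
    have b2 : (2 / k : ℝ) ^ 2 ≤ 4 * (k * √k)⁻¹ := by
      rw [div_pow, ← div_eq_mul_inv]
      norm_num
      gcongr
      nlinarith
    calc _ = ‖(chiSqLogCharFun k s - (1 - z)) - (Complex.exp (-z) - 1 - (-z))‖ := by
          congr 1; ring
      _ ≤ 384 * ((k : ℝ) / 2 * √(k / 2))⁻¹ + (2 / k) ^ 2 :=
          (norm_sub_le _ _).trans (add_le_add hA hE)
      _ ≤ _ := by
          have : 0 ≤ ((k : ℝ) * √k)⁻¹ := by positivity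
          linarith

lemma tendsto_prod_chiSqLogCharFun {s : ℕ → ℝ} {θ : ℝ} (hs : Tendsto s atTop (nhds 0))
    (hθ : Tendsto (fun n : ℕ ↦ s n ^ 2 * Real.log n) atTop (nhds θ)) :
    Tendsto (fun n : ℕ ↦ Complex.exp (Complex.I * s n * Real.log n) *
      ∏ k ∈ Finset.range n, chiSqLogCharFun (k + 1) (s n)) atTop (nhds (Complex.exp (-θ))) := by
  set b : ℕ → ℕ → ℂ := fun n k ↦
    Complex.exp (-((s n ^ 2 + Complex.I * s n) / (k + 1 : ℕ))) with hb
  have hlim : Tendsto (fun n : ℕ ↦ Complex.exp (Complex.I * s n * Real.log n) *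
      ∏ k ∈ Finset.range n, b n k) atTop (nhds (Complex.exp (-θ))) := by
    have hγ := Real.tendsto_harmonic_sub_log
    have h1 : Tendsto (fun n : ℕ ↦ -(s n ^ 2 * Real.log n + s n ^ 2 * (harmonic n - Real.log n)))
        atTop (nhds (-θ)) := by
      simpa using (hθ.add ((hs.pow 2).mul hγ)).neg
    have h2 : Tendsto (fun n : ℕ ↦ -(s n * (harmonic n - Real.log n))) atTop (nhds 0) := by
      simpa using (hs.mul hγ).neg
    have h3 := ((Complex.continuous_ofReal.tendsto _).comp h1).add
      (((Complex.continuous_ofReal.tendsto _).comp h2).const_mul Complex.I)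
    simp only [Complex.ofReal_zero, mul_zero, add_zero] at h3
    have h4 := (Complex.continuous_exp.tendsto _).comp h3
    rw [Complex.ofReal_neg] at h4
    refine h4.congr fun n ↦ ?_
    simp only [hb, Function.comp_apply]
    rw [← Complex.exp_sum, ← Complex.exp_add]
    congr 1
    have hH : ((harmonic n : ℝ) : ℂ) = ∑ k ∈ Finset.range n, ((k + 1 : ℕ) : ℂ)⁻¹ := by
      simp [harmonic]
    rw [Finset.sum_neg_distrib]
    simp only [div_eq_mul_inv]
    rw [← Finset.mul_sum, ← hH]
    push_cast
    ring
  have hdiff : Tendsto (fun n ↦ ∑ k ∈ Finset.range n, ‖chiSqLogCharFun (k + 1) (s n) - b n k‖)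
      atTop (nhds 0) := by
    have hsum : Summable fun k : ℕ ↦ 2000 * (((k + 1 : ℕ) : ℝ) * √((k + 1 : ℕ) : ℝ))⁻¹ := by
      refine Summable.mul_left _ ?_
      have := (summable_nat_add_iff 1).2 (Real.summable_nat_rpow_inv.2
        (show (1 : ℝ) < 3 / 2 by norm_num))
      refine this.congr fun k ↦ ?_
      rw [show (3 / 2 : ℝ) = 1 + 1 / 2 by norm_num, Real.rpow_add (by positivity), Real.rpow_one,
        Real.sqrt_eq_rpow]
    have key := tendsto_tsum_of_dominated_convergence (𝓕 := atTop)
      (f := fun n k ↦ if k ∈ Finset.range n then ‖chiSqLogCharFun (k + 1) (s n) - b n k‖ else 0)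
      (g := fun _ ↦ (0 : ℝ)) hsum ?_ ?_
    · rw [tsum_zero] at key
      refine key.congr fun n ↦ ?_
      rw [tsum_eq_sum (s := Finset.range n) (fun k hk ↦ by simp only [if_neg hk])]
      exact Finset.sum_congr rfl fun k hk ↦ by simp only [if_pos hk]
    · intro k
      have hk : Tendsto (fun n ↦ ‖chiSqLogCharFun (k + 1) (s n) - b n k‖) atTop (nhds 0) := by
        have h1 := (tendsto_chiSqLogCharFun k.succ_pos).comp hs
        have h2 : Tendsto (fun n ↦ b n k) atTop (nhds 1) := by
          have : Continuous fun x : ℝ ↦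
            Complex.exp (-((x ^ 2 + Complex.I * x) / (k + 1 : ℕ))) := by fun_prop
          have h := (this.tendsto 0).comp hs
          simp only [Complex.ofReal_zero, ne_eq, OfNat.ofNat_ne_zero, not_false_eq_true, zero_pow,
            mul_zero, add_zero, zero_div, neg_zero, Complex.exp_zero] at h
          exact h
        simpa using (h1.sub h2).norm
      refine hk.congr' ?_
      filter_upwards [eventually_gt_atTop k] with n hn
      rw [if_pos (Finset.mem_range.2 hn)]
    · have : ∀ᶠ n in atTop, |s n| ≤ 1 := by
        have := hs.abs
        rw [abs_zero] at this
        exact this.eventually_le_const one_pos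
      filter_upwards [this] with n hn k
      split_ifs with h
      · rw [norm_norm]
        exact norm_chiSqLogCharFun_sub_exp_le k.succ_pos hn
      · rw [norm_zero]
        positivity
  rw [tendsto_iff_norm_sub_tendsto_zero] at hlim ⊢
  refine squeeze_zero (fun _ ↦ norm_nonneg _) (fun n ↦ ?_) (add_zero (0 : ℝ) ▸ hdiff.add hlim)
  calc _ = ‖Complex.exp (Complex.I * s n * Real.log n) *
        (∏ k ∈ Finset.range n, chiSqLogCharFun (k + 1) (s n) - ∏ k ∈ Finset.range n, b n k) +
        (Complex.exp (Complex.I * s n * Real.log n) * ∏ k ∈ Finset.range n, b n k -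
          Complex.exp (-θ))‖ := by congr 1; ring
    _ ≤ _ := by
      refine (norm_add_le _ _).trans ?_
      rw [norm_mul, Complex.norm_exp_I_mul_mul_ofReal, one_mul]
      gcongr
      exact norm_prod_sub_prod_le_sum _ (fun k _ ↦ norm_chiSqLogCharFun_le k.succ_pos _)
        (fun k _ ↦ norm_exp_neg_div_le _ _)

lemma mgf_gammaMeasure {a r t : ℝ} (ha : 0 < a) (hr : 0 < r) (ht : t < r) :
    mgf id (gammaMeasure a r) t = (r / (r - t)) ^ a := by
  rw [mgf, integral_gammaMeasure ha hr]
  have hG := (Real.Gamma_pos_of_pos ha).ne'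
  have key := Real.integral_rpow_mul_exp_neg_mul_Ioi ha (sub_pos.2 ht)
  calc _ = ∫ x in Set.Ioi (0 : ℝ), r ^ a / Real.Gamma a *
        (x ^ (a - 1) * Real.exp (-((r - t) * x))) := by
        refine integral_congr_ae (.of_forall fun x ↦ ?_)
        simp only [smul_eq_mul, id]
        rw [show -((r - t) * x) = -(r * x) + t * x by ring, Real.exp_add]
        ring
    _ = _ := by
        rw [integral_const_mul, key, Real.div_rpow hr.le (sub_pos.2 ht).le,
          Real.div_rpow zero_le_one (sub_pos.2 ht).le, Real.one_rpow]
        field_simp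

lemma mgf_gammaMeasure_of_le {a r t : ℝ} (ha : 0 < a) (hr : 0 < r) (ht : r ≤ t) :
    mgf id (gammaMeasure a r) t = 0 := by
  rw [mgf, integral_gammaMeasure ha hr]
  have hG := Real.Gamma_pos_of_pos ha
  refine integral_undef fun h ↦ not_integrableOn_Ioi_rpow (a - 1) ?_
  refine (h.const_mul (r ^ a / Real.Gamma a)⁻¹).mono' (by fun_prop) ?_
  refine (ae_restrict_iff' measurableSet_Ioi).2 (.of_forall fun x hx ↦ ?_)
  have hx' : 0 < x := hx
  rw [Real.norm_of_nonneg (by positivity), smul_eq_mul, id, ← mul_assoc, inv_mul_cancel_left₀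
    (by positivity), mul_assoc, ← Real.exp_add]
  refine le_mul_of_one_le_right (by positivity) (Real.one_le_exp ?_)
  nlinarith

lemma mgf_sq_gaussianReal (t : ℝ) :
    ∫ x, Real.exp (t * x ^ 2) ∂(gaussianReal 0 1) = √(1 / 2 / (1 / 2 - t)) := by
  rw [integral_gaussianReal_eq_integral_smul one_ne_zero]
  calc _ = ∫ x : ℝ, (√(2 * Real.pi))⁻¹ * Real.exp (-(1 / 2 - t) * x ^ 2) := by
        refine integral_congr_ae (.of_forall fun x ↦ ?_)
        simp only [gaussianPDFReal, smul_eq_mul, NNReal.coe_one, mul_one, sub_zero]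
        rw [mul_assoc, ← Real.exp_add]
        congr 2
        ring
    _ = _ := by
        rw [integral_const_mul, integral_gaussian, ← Real.sqrt_inv,
          ← Real.sqrt_mul (by positivity)]
        congr 1
        have := Real.pi_ne_zero
        field_simp

/-- The sum of squares of `k` independent standard Gaussians has a `χ²` law. -/
lemma map_sum_sq_pi_gaussianReal {k : ℕ} (hk : 0 < k) :
    (Measure.pi fun _ : Fin k ↦ gaussianReal 0 1).map (fun v ↦ ∑ i, v i ^ 2) =
      gammaMeasure (k / 2) (1 / 2) := by
  have hk' : (0 : ℝ) < k / 2 := by positivity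
  have hr : (0 : ℝ) < 1 / 2 := by norm_num
  have := isProbabilityMeasure_gammaMeasure hk' hr
  have hmgf : mgf id (gammaMeasure (k / 2) (1 / 2)) =
      mgf (fun v ↦ ∑ i, v i ^ 2) (Measure.pi fun _ : Fin k ↦ gaussianReal 0 1) := by
    ext t
    have h : mgf (fun v ↦ ∑ i, v i ^ 2) (Measure.pi fun _ : Fin k ↦ gaussianReal 0 1) t =
        √(1 / 2 / (1 / 2 - t)) ^ k := by
      simp only [mgf, Finset.mul_sum, Real.exp_sum]
      rw [integral_fintype_prod_eq_prod (fun _ x ↦ Real.exp (t * x ^ 2))]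
      simp only [mgf_sq_gaussianReal, Finset.prod_const, Finset.card_univ, Fintype.card_fin]
    rw [h]
    obtain ht | ht := lt_or_ge t (1 / 2)
    · have : 0 ≤ 1 / 2 / (1 / 2 - t) := div_nonneg hr.le (by linarith)
      rw [mgf_gammaMeasure hk' hr ht, Real.sqrt_eq_rpow, ← Real.rpow_mul_natCast this]
      congr 1
      ring
    · rw [mgf_gammaMeasure_of_le hk' hr ht, Real.sqrt_eq_zero_of_nonpos
        (div_nonpos_of_nonneg_of_nonpos hr.le (by linarith)), zero_pow hk.ne']
  have h_integrable : Set.Iio (1 / 2) ⊆ integrableExpSet id (gammaMeasure (k / 2) (1 / 2)) := by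
    intro t ht
    refine .of_integral_ne_zero ?_
    have h := mgf_gammaMeasure hk' hr ht
    rw [mgf] at h
    rw [h]
    have : 0 < 1 / 2 - t := sub_pos.2 ht
    positivity
  refine Measure.ext_of_charFun (funext fun t ↦ ?_)
  have h := eqOn_complexMGF_of_mgf hmgf (x := t * Complex.I)
    (interior_mono h_integrable (by simp [isOpen_Iio.interior_eq]))
  rw [← complexMGF_id_mul_I, ← complexMGF_id_mul_I, h,
    complexMGF_id_map (Measurable.aemeasurable (by fun_prop))]

lemma measurePreserving_linearIsometryEquiv_pi_gaussianReal {ι : Type*} [Fintype ι]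
    (U : EuclideanSpace ℝ ι ≃ₗᵢ[ℝ] EuclideanSpace ℝ ι) :
    MeasurePreserving (fun v : ι → ℝ ↦ (U (WithLp.toLp 2 v)).ofLp)
      (Measure.pi fun _ ↦ gaussianReal 0 1) (Measure.pi fun _ ↦ gaussianReal 0 1) where
  measurable := by fun_prop
  map_eq := by
    have h : (Measure.pi fun _ : ι ↦ gaussianReal 0 1) =
        (stdGaussian (EuclideanSpace ℝ ι)).map WithLp.ofLp := by
      rw [← map_pi_eq_stdGaussian, Measure.map_map (by fun_prop) (by fun_prop)]
      exact Measure.map_id.symm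
    conv_rhs => rw [h, ← stdGaussian_map U, ← map_pi_eq_stdGaussian]
    rw [Measure.map_map (by fun_prop) (by fun_prop), Measure.map_map (by fun_prop) (by fun_prop)]
    rfl

lemma exists_det_reflection_row {ι : Type*} [Fintype ι] [DecidableEq ι] (v : ι → ℝ) (i₀ : ι) :
    ∃ U : EuclideanSpace ℝ ι ≃ₗᵢ[ℝ] EuclideanSpace ℝ ι,
      (U (WithLp.toLp 2 v)).ofLp = Pi.single i₀ √(∑ i, v i ^ 2) ∧
      ∀ A : ι → ι → ℝ,
        (Matrix.of fun i ↦ (U (WithLp.toLp 2 (A i))).ofLp).det ^ 2 = (Matrix.of A).det ^ 2 := by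
  set w : EuclideanSpace ℝ ι := EuclideanSpace.single i₀ ‖WithLp.toLp 2 v‖ with hw
  have hnorm : ‖WithLp.toLp 2 v‖ = ‖w‖ := by simp [hw]
  set K := (Submodule.span ℝ {WithLp.toLp 2 v - w})ᗮ
  refine ⟨K.reflection, ?_, fun A ↦ ?_⟩
  · rw [Submodule.reflection_sub hnorm, hw, EuclideanSpace.norm_eq]
    simp
  · set f : (ι → ℝ) →ₗ[ℝ] (ι → ℝ) :=
      ((WithLp.linearEquiv 2 ℝ (ι → ℝ) : _ →ₗ[ℝ] _) ∘ₗ K.reflection.toLinearMap ∘ₗ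
        ((WithLp.linearEquiv 2 ℝ (ι → ℝ)).symm : _ →ₗ[ℝ] _)) with hf
    have hdet : (LinearMap.toMatrix' f).det ^ 2 = 1 := by
      rw [LinearMap.det_toMatrix', hf, LinearMap.det_conj, Submodule.det_reflection, ← pow_mul,
        mul_comm, pow_mul]
      simp
    have hmul : (Matrix.of fun i ↦ (K.reflection (WithLp.toLp 2 (A i))).ofLp) =
        Matrix.of A * (LinearMap.toMatrix' f)ᵀ := by
      ext i j
      have : (K.reflection (WithLp.toLp 2 (A i))).ofLp = f (A i) := rfl
      rw [Matrix.of_apply, this, ← LinearMap.toMatrix'_mulVec f (A i), Matrix.mul_apply]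
      simp [Matrix.mulVec, dotProduct, mul_comm]
    rw [hmul, Matrix.det_mul, Matrix.det_transpose, mul_pow, hdet, mul_one]

lemma Matrix.det_cons_single {R : Type*} [CommRing R] {n : ℕ} (c : R)
    (A : Fin n → Fin (n + 1) → R) :
    (Matrix.of (Fin.cons (Pi.single 0 c) A : Fin (n + 1) → Fin (n + 1) → R)).det =
      c * (Matrix.of fun i j ↦ A i (Fin.succ j)).det := by
  rw [Matrix.det_succ_row_zero, Finset.sum_eq_single 0]
  · simp only [Matrix.of_apply, Fin.cons_zero, Pi.single_eq_same, Fin.val_zero, pow_zero, one_mul]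
    rfl
  · intro j _ hj
    simp [hj]
  · simp

@[fun_prop]
lemma measurable_det_of {n : ℕ} : Measurable fun A : Fin n → Fin n → ℝ ↦ (Matrix.of A).det := by
  simp only [Matrix.det_apply, Matrix.of_apply]
  fun_prop

/-- The law of the squared determinant of a Gaussian matrix. -/
noncomputable def detSqGaussianMeasure (n : ℕ) : Measure ℝ :=
  (Measure.pi fun _ : Fin n ↦ Measure.pi fun _ : Fin n ↦ gaussianReal 0 1).map
    fun A ↦ (Matrix.of A).det ^ 2

instance (n : ℕ) : IsProbabilityMeasure (detSqGaussianMeasure n) :=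
  Measure.isProbabilityMeasure_map (Measurable.aemeasurable (by fun_prop))

lemma lintegral_det_cons_sq {n : ℕ} (v : Fin (n + 1) → ℝ) {F : ℝ → ENNReal} (hF : Measurable F) :
    ∫⁻ A, F ((Matrix.of (Fin.cons v A : Fin (n + 1) → Fin (n + 1) → ℝ)).det ^ 2)
      ∂(Measure.pi fun _ : Fin n ↦ Measure.pi fun _ : Fin (n + 1) ↦ gaussianReal 0 1) =
    ∫⁻ x, F ((∑ i, v i ^ 2) * x) ∂(detSqGaussianMeasure n) := by
  obtain ⟨U, hU, hdet⟩ := exists_det_reflection_row v 0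
  have hmp := measurePreserving_pi (fun _ : Fin n ↦ Measure.pi fun _ : Fin (n + 1) ↦
    gaussianReal 0 1) _ fun _ ↦ measurePreserving_linearIsometryEquiv_pi_gaussianReal U
  have htail : MeasurePreserving (fun v : Fin (n + 1) → ℝ ↦ fun j : Fin n ↦ v j.succ)
      (Measure.pi fun _ ↦ gaussianReal 0 1) (Measure.pi fun _ ↦ gaussianReal 0 1) :=
    measurePreserving_snd.comp
      (measurePreserving_piFinSuccAbove (fun _ : Fin (n + 1) ↦ gaussianReal 0 1) 0)
  have hmp' := measurePreserving_pi (fun _ : Fin n ↦ Measure.pi fun _ : Fin (n + 1) ↦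
    gaussianReal 0 1) _ fun _ ↦ htail
  have hcons (A : Fin n → Fin (n + 1) → ℝ) :
      (Matrix.of (Fin.cons v A : Fin (n + 1) → Fin (n + 1) → ℝ)).det ^ 2 =
      (∑ i, v i ^ 2) *
        (Matrix.of fun i j ↦ (U (WithLp.toLp 2 (A i))).ofLp (Fin.succ j)).det ^ 2 := by
    rw [← hdet]
    have : (fun i ↦ (U (WithLp.toLp 2 ((Fin.cons v A : Fin (n + 1) → Fin (n + 1) → ℝ) i))).ofLp) =
        Fin.cons (Pi.single 0 √(∑ i, v i ^ 2)) fun i ↦ (U (WithLp.toLp 2 (A i))).ofLp := by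
      ext i
      refine Fin.cases ?_ (fun i ↦ ?_) i
      · simp only [Fin.cons_zero, hU]
      · simp only [Fin.cons_succ]
    rw [this, Matrix.det_cons_single, mul_pow, Real.sq_sqrt (by positivity)]
  simp only [hcons]
  rw [detSqGaussianMeasure, lintegral_map (by fun_prop) (by fun_prop)]
  exact (hmp'.comp hmp).lintegral_comp
    (f := fun A : Fin n → Fin n → ℝ ↦ F ((∑ i, v i ^ 2) * (Matrix.of A).det ^ 2)) (by fun_prop)

lemma detSqGaussianMeasure_zero : detSqGaussianMeasure 0 = Measure.dirac 1 := by
  simp [detSqGaussianMeasure, Matrix.det_isEmpty]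

lemma detSqGaussianMeasure_succ (n : ℕ) :
    detSqGaussianMeasure (n + 1) =
      ((gammaMeasure ((n + 1 : ℕ) / 2) (1 / 2)).prod (detSqGaussianMeasure n)).map
        fun p ↦ p.1 * p.2 := by
  ext s hs
  have hF : Measurable (s.indicator (1 : ℝ → ENNReal)) := measurable_one.indicator hs
  have hm : Measurable fun p ↦ s.indicator (1 : ℝ → ENNReal) ((Matrix.of
      ((MeasurableEquiv.piFinSuccAbove (fun _ : Fin (n + 1) ↦ Fin (n + 1) → ℝ) 0).symm p)).det ^ 2) :=
    hF.comp ((measurable_det_of.pow_const 2).comp (MeasurableEquiv.measurable _))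
  rw [← lintegral_indicator_one hs, ← lintegral_indicator_one hs,
    lintegral_map hF (by fun_prop), detSqGaussianMeasure, lintegral_map hF (by fun_prop),
    ← map_sum_sq_pi_gaussianReal n.succ_pos,
    ← (measurePreserving_piFinSuccAbove
      (fun _ : Fin (n + 1) ↦ Measure.pi fun _ : Fin (n + 1) ↦
        gaussianReal 0 1) 0).symm.lintegral_comp (by fun_prop), lintegral_prod _ hm.aemeasurable, lintegral_prod _ (by fun_prop),
      lintegral_map (by fun_prop) (by fun_prop)]
  refine lintegral_congr fun v ↦ ?_
  rw [← lintegral_det_cons_sq v hF]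
  simp only [MeasurableEquiv.piFinSuccAbove_symm_apply, Fin.insertNthEquiv_zero]
  rfl

lemma pi_gaussianReal_map_curry (m n : ℕ) :
    (Measure.pi fun _ : Fin m × Fin n ↦ gaussianReal 0 1).map (fun Y i j ↦ Y (i, j)) =
      Measure.pi fun _ : Fin m ↦ Measure.pi fun _ : Fin n ↦ gaussianReal 0 1 := by
  have h := Measure.infinitePi_map_curry (fun (_ : Fin m) (_ : Fin n) ↦ gaussianReal 0 1)
  simp only [Measure.infinitePi_eq_pi] at h
  exact h

lemma ae_pos_detSqGaussianMeasure (n : ℕ) : ∀ᵐ x ∂(detSqGaussianMeasure n), 0 < x := by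
  induction n with
  | zero => simp [detSqGaussianMeasure_zero, ae_dirac_eq]
  | succ n ih =>
    have := isProbabilityMeasure_gammaMeasure
      (show (0 : ℝ) < (n + 1 : ℕ) / 2 by positivity) (one_half_pos (α := ℝ))
    rw [detSqGaussianMeasure_succ, ae_map_iff (by fun_prop) measurableSet_Ioi]
    filter_upwards [Measure.quasiMeasurePreserving_fst.ae (ae_pos_gammaMeasure _ _),
      Measure.quasiMeasurePreserving_snd.ae ih] with p h1 h2
    exact mul_pos h1 h2

lemma integral_exp_log_gammaMeasure_eq {k : ℕ} (hk : 0 < k) (s : ℝ) :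
    ∫ x, Complex.exp (Complex.I * s * Real.log x) ∂(gammaMeasure (k / 2) (1 / 2)) =
      Complex.exp (Complex.I * s * Real.log k) * chiSqLogCharFun k s := by
  rw [chiSqLogCharFun, ← integral_const_mul]
  refine integral_congr_ae ?_
  filter_upwards [ae_pos_gammaMeasure (k / 2) (1 / 2)] with x hx
  have hk' : (k : ℝ) ≠ 0 := by positivity
  rw [← Complex.exp_add, show (1 / 2 * x / (k / 2) : ℝ) = x / k by field_simp,
    Real.log_div hx.ne' hk']
  congr 1
  push_cast
  ring

lemma integral_exp_log_detSqGaussianMeasure (n : ℕ) (s : ℝ) :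
    ∫ x, Complex.exp (Complex.I * s * Real.log x) ∂(detSqGaussianMeasure n) =
      Complex.exp (Complex.I * s * Real.log n.factorial) *
        ∏ k ∈ Finset.range n, chiSqLogCharFun (k + 1) s := by
  induction n with
  | zero => simp [detSqGaussianMeasure_zero]
  | succ n ih =>
    have := isProbabilityMeasure_gammaMeasure
      (show (0 : ℝ) < (n + 1 : ℕ) / 2 by positivity) (one_half_pos (α := ℝ))
    rw [detSqGaussianMeasure_succ, integral_map (by fun_prop)
      (Measurable.aestronglyMeasurable (by fun_prop))]
    have h : ∀ᵐ p ∂((gammaMeasure ((n + 1 : ℕ) / 2) (1 / 2)).prod (detSqGaussianMeasure n)),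
        Complex.exp (Complex.I * s * Real.log (p.1 * p.2)) =
        Complex.exp (Complex.I * s * Real.log p.1) * Complex.exp (Complex.I * s * Real.log p.2) := by
      filter_upwards [Measure.quasiMeasurePreserving_fst.ae (ae_pos_gammaMeasure _ _),
        Measure.quasiMeasurePreserving_snd.ae (ae_pos_detSqGaussianMeasure n)] with p h1 h2
      rw [Real.log_mul h1.ne' h2.ne', Complex.ofReal_add, mul_add, Complex.exp_add]
    rw [integral_congr_ae h,
      integral_prod_mul (fun x : ℝ ↦ Complex.exp (Complex.I * s * Real.log x))
      (fun x : ℝ ↦ Complex.exp (Complex.I * s * Real.log x)), ih,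
      integral_exp_log_gammaMeasure_eq n.succ_pos, Nat.factorial_succ, Nat.cast_mul,
      Real.log_mul (by positivity) (by positivity), Finset.prod_range_succ, Complex.ofReal_add,
      mul_add, Complex.exp_add]
    ring

/-- The normalization of `log |det Y|`, as a function of `(det Y) ^ 2`. -/
noncomputable def normalizedLogDet (n : ℕ) (x : ℝ) : ℝ :=
  (1 / 2 * Real.log x - 1 / 2 * Real.log (n - 1).factorial) / √(1 / 2 * Real.log n)

@[fun_prop]
lemma measurable_normalizedLogDet (n : ℕ) : Measurable (normalizedLogDet n) := by
  unfold normalizedLogDet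
  fun_prop

lemma charFun_map_normalizedLogDet {n : ℕ} (hn : 0 < n) (t : ℝ) :
    charFun ((detSqGaussianMeasure n).map (normalizedLogDet n)) t =
      Complex.exp (Complex.I * (t / (2 * √(1 / 2 * Real.log n)) : ℝ) * Real.log n) *
        ∏ k ∈ Finset.range n, chiSqLogCharFun (k + 1) (t / (2 * √(1 / 2 * Real.log n))) := by
  set s := t / (2 * √(1 / 2 * Real.log n)) with hs
  rw [charFun_apply_real, integral_map (by fun_prop)
    (Measurable.aestronglyMeasurable (by fun_prop))]
  have h (x : ℝ) : Complex.exp (t * normalizedLogDet n x * Complex.I) =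
      Complex.exp (-(Complex.I * s * Real.log (n - 1).factorial)) *
        Complex.exp (Complex.I * s * Real.log x) := by
    have : t * normalizedLogDet n x = s * (Real.log x - Real.log (n - 1).factorial) := by
      rw [hs, normalizedLogDet, ← mul_sub, mul_div_assoc', mul_left_comm, div_mul_eq_mul_div,
        mul_comm 2 (√ _), ← div_div]
      ring
    rw [← Complex.exp_add, ← Complex.ofReal_mul, this]
    congr 1
    push_cast
    ring
  simp only [h]
  rw [integral_const_mul, integral_exp_log_detSqGaussianMeasure, ← mul_assoc, ← Complex.exp_add,
    ← Nat.mul_factorial_pred hn.ne', Nat.cast_mul, Real.log_mul (by positivity) (by positivity)]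
  congr 2
  push_cast
  ring

lemma tendsto_charFun_map_normalizedLogDet (t : ℝ) :
    Tendsto (fun n ↦ charFun ((detSqGaussianMeasure n).map (normalizedLogDet n)) t) atTop
      (nhds (charFun (gaussianReal 0 1) t)) := by
  have hlog : Tendsto (fun n : ℕ ↦ Real.log n) atTop atTop :=
    Real.tendsto_log_atTop.comp tendsto_natCast_atTop_atTop
  have hs : Tendsto (fun n : ℕ ↦ t / (2 * √(1 / 2 * Real.log n))) atTop (nhds 0) :=
    tendsto_const_nhds.div_atTop ((Real.tendsto_sqrt_atTop.comp
      (hlog.const_mul_atTop one_half_pos)).const_mul_atTop two_pos)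
  have hθ : Tendsto (fun n : ℕ ↦ (t / (2 * √(1 / 2 * Real.log n))) ^ 2 * Real.log n) atTop
      (nhds (t ^ 2 / 2)) := by
    refine tendsto_const_nhds.congr' ?_
    filter_upwards [hlog.eventually_gt_atTop 0] with n hn
    rw [div_pow, mul_pow, Real.sq_sqrt (by positivity)]
    field_simp
  have key := tendsto_prod_chiSqLogCharFun hs hθ
  have hlim : charFun (gaussianReal 0 1) t = Complex.exp (-(t ^ 2 / 2 : ℝ)) := by
    rw [charFun_gaussianReal]
    congr 1
    simp
  rw [hlim]
  refine key.congr' ?_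
  filter_upwards [eventually_gt_atTop 0] with n hn
  rw [charFun_map_normalizedLogDet hn]

/-- **CLT for the log absolute determinant of a Gaussian random matrix**: if `Y` is an
`n × n` matrix with i.i.d. standard Gaussian entries, then
`(log |det Y| − (1/2) log (n−1)!)/√((1/2) log n) → N(0,1)` in distribution. -/
theorem log_abs_det_gaussian_matrix_clt :
    ∀ x : ℝ,
      Tendsto
        (fun n =>
          ((Measure.pi fun _ : Fin n × Fin n => gaussianReal 0 1)
              {Y : Fin n × Fin n → ℝ |
                (Real.log |Matrix.det (Matrix.of fun i j => Y (i, j))| -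
                      (1 / 2) * Real.log (Nat.factorial (n - 1))) /
                    Real.sqrt ((1 / 2) * Real.log n) ≤ x}).toReal)
        atTop (nhds (stdGaussianCDF x)) := by
  intro x
  let μ (n : ℕ) : ProbabilityMeasure ℝ := ⟨(detSqGaussianMeasure n).map (normalizedLogDet n),
    Measure.isProbabilityMeasure_map (by fun_prop)⟩
  let γ : ProbabilityMeasure ℝ := ⟨gaussianReal 0 1, inferInstance⟩
  have hμ : Tendsto μ atTop (nhds γ) :=
    ProbabilityMeasure.tendsto_iff_tendsto_charFun.2 tendsto_charFun_map_normalizedLogDet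
  have hγ : (γ : Measure ℝ) (frontier (Set.Iic x)) = 0 := by
    have := nullSingletonClass_gaussianReal (μ := 0) (v := 1) one_ne_zero
    rw [frontier_Iic]
    exact this.measure_singleton x
  have h := (ENNReal.tendsto_toReal (measure_ne_top _ _)).comp
    (ProbabilityMeasure.tendsto_measure_of_null_frontier_of_tendsto' hμ hγ)
  refine h.congr fun n ↦ ?_
  have hset : {Y : Fin n × Fin n → ℝ |
      (Real.log |Matrix.det (Matrix.of fun i j => Y (i, j))| -
        (1 / 2) * Real.log (Nat.factorial (n - 1))) / Real.sqrt ((1 / 2) * Real.log n) ≤ x} =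
      (fun Y i j ↦ Y (i, j)) ⁻¹' ((fun A : Fin n → Fin n → ℝ ↦ (Matrix.of A).det ^ 2) ⁻¹'
        (normalizedLogDet n ⁻¹' Set.Iic x)) := by
    ext Y
    simp [normalizedLogDet, Real.log_abs, Real.log_pow]
  have hx := measurable_normalizedLogDet n (measurableSet_Iic (a := x))
  change (((detSqGaussianMeasure n).map (normalizedLogDet n)) (Set.Iic x)).toReal = _
  rw [hset, Measure.map_apply (by fun_prop) measurableSet_Iic, detSqGaussianMeasure,
    Measure.map_apply (by fun_prop) hx, ← pi_gaussianReal_map_curry,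
    Measure.map_apply (by fun_prop) ((measurable_det_of.pow_const 2) hx)]
end
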